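/- arXiv:2404.11507 — 8 statements merged into one kernel-verified Lean document; each statement's English description precedes it below -/
import Mathlib

section
/- Let (X, μ) be a probability space, T : X → X an ergodic measure-preserving transformation, and f ∈ L¹(μ) a real-valued function that is not a.e. equal to a constant. Then for almost every x ∈ X there are infinitely many N with A_{N+1} f(x) > A_N f(x) and infinitely many N with A_{N+1} f(x) < A_N f(x); in particular, the sequence (A_N f(x))_{N≥1} is neither eventually non-decreasing nor eventually non-increasing. -/
open MeasureTheory Filter

/-- Birkhoff (ergodic) average `A_N f(x) = (1/N) ∑_{n=1}^N f(Tⁿ x)`. -/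
noncomputable def birkhoffAvg {X : Type*} (T : X → X) (f : X → ℝ) (N : ℕ) (x : X) : ℝ :=
  (N : ℝ)⁻¹ * ∑ n ∈ Finset.Icc 1 N, f (T^[n] x)

section OrbitVisits

variable {X : Type*} [MeasurableSpace X] {μ : Measure X} {T : X → X} {f : X → ℝ}

/-- Almost every orbit of an ergodic map of a finite measure space visits a given set of positive
measure infinitely often. -/
theorem Ergodic.ae_frequently_iterate_mem [IsFiniteMeasure μ] (hT : Ergodic T μ) {s : Set X}
    (hs : NullMeasurableSet s μ) (h0 : μ s ≠ 0) :
    ∀ᵐ x ∂μ, ∃ᶠ n in atTop, T^[n] x ∈ s := by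
  have hU : NullMeasurableSet (⋃ n : ℕ, T^[n] ⁻¹' s) μ :=
    .iUnion fun n => hs.preimage (hT.quasiMeasurePreserving.iterate n)
  have hinv : T ⁻¹' (⋃ n : ℕ, T^[n] ⁻¹' s) ⊆ ⋃ n : ℕ, T^[n] ⁻¹' s := by
    intro x hx
    obtain ⟨n, hn⟩ := Set.mem_iUnion.1 hx
    exact Set.mem_iUnion.2 ⟨n + 1, hn⟩
  rcases hT.ae_empty_or_univ_of_preimage_ae_le hU hinv.eventuallyLE with h | h
  · exact absurd (measure_mono_null (Set.subset_iUnion (fun n : ℕ => T^[n] ⁻¹' s) 0)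
      (ae_eq_empty.1 h)) h0
  · filter_upwards [eventuallyEq_univ.1 h,
      hT.toMeasurePreserving.conservative.ae_forall_image_mem_imp_frequently_image_mem hs]
      with x hx hrec
    obtain ⟨k, hk⟩ := Set.mem_iUnion.1 hx
    exact hrec k hk

/-- If `f` is essentially bounded above by every rational larger than `c`, it is essentially
bounded above by `c`. -/
theorem ae_le_of_forall_rat_gt {c : ℝ} (h : ∀ q : ℚ, c < q → ∀ᵐ y ∂μ, f y ≤ q) :
    ∀ᵐ y ∂μ, f y ≤ c := by
  have h' : ∀ᵐ y ∂μ, ∀ q : ℚ, c < q → f y ≤ q :=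
    ae_all_iff.2 fun q => eventually_imp_distrib_left.2 (h q)
  filter_upwards [h'] with y hy
  exact le_of_forall_lt_rat_imp_le hy

/-- Almost every orbit of an ergodic map exceeds infinitely often every level that is not an
essential upper bound of `f`. -/
theorem Ergodic.ae_forall_ae_le_or_frequently_lt [IsFiniteMeasure μ] (hT : Ergodic T μ)
    (hf : AEMeasurable f μ) :
    ∀ᵐ x ∂μ, ∀ c : ℝ, (∀ᵐ y ∂μ, f y ≤ c) ∨ ∃ᶠ n in atTop, c < f (T^[n] x) := by
  have h : ∀ᵐ x ∂μ, ∀ q : ℚ, (∀ᵐ y ∂μ, f y ≤ q) ∨ ∃ᶠ n in atTop, (q : ℝ) < f (T^[n] x) := by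
    refine ae_all_iff.2 fun q => ?_
    by_cases hq : ∀ᵐ y ∂μ, f y ≤ q
    · exact .of_forall fun _ => .inl hq
    · refine (hT.ae_frequently_iterate_mem (s := {y | (q : ℝ) < f y})
        (nullMeasurableSet_lt aemeasurable_const hf) ?_).mono fun _ hx => .inr hx
      simpa [ae_iff] using hq
  filter_upwards [h] with x hx c
  refine or_iff_not_imp_right.2 fun hc => ae_le_of_forall_rat_gt fun q hq => ?_
  exact (hx q).resolve_right fun hfr => hc (hfr.mono fun n hn => hq.trans hn)

/-- Along almost every orbit, `f` is bounded by all of its essential upper bounds. -/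
theorem MeasureTheory.Measure.QuasiMeasurePreserving.ae_forall_iterate_le
    (hT : Measure.QuasiMeasurePreserving T μ μ) :
    ∀ᵐ x ∂μ, ∀ c : ℝ, (∀ᵐ y ∂μ, f y ≤ c) → ∀ n : ℕ, f (T^[n] x) ≤ c := by
  have h : ∀ᵐ x ∂μ, ∀ q : ℚ, (∀ᵐ y ∂μ, f y ≤ q) → ∀ n : ℕ, f (T^[n] x) ≤ q :=
    ae_all_iff.2 fun q => eventually_imp_distrib_left.2 fun hq =>
      ae_all_iff.2 fun n => (hT.iterate n).ae hq
  filter_upwards [h] with x hx c hc n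
  exact le_of_forall_lt_rat_imp_le fun q hq =>
    hx q (hc.mono fun y hy => hy.trans hq.le) n

end OrbitVisits

section BirkhoffAvg

variable {X : Type*} {T : X → X} {f : X → ℝ}

theorem birkhoffAvg_neg (T : X → X) (f : X → ℝ) (N : ℕ) (x : X) :
    birkhoffAvg T (-f) N x = -birkhoffAvg T f N x := by
  simp [birkhoffAvg]

theorem mul_birkhoffAvg (T : X → X) (f : X → ℝ) (N : ℕ) (x : X) :
    N * birkhoffAvg T f N x = ∑ n ∈ Finset.Icc 1 N, f (T^[n] x) := by
  rcases eq_or_ne N 0 with rfl | hN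
  · simp
  · rw [birkhoffAvg, mul_inv_cancel_left₀ (Nat.cast_ne_zero.2 hN)]

theorem iterate_succ_le_birkhoffAvg {N : ℕ} {x : X}
    (h : birkhoffAvg T f (N + 1) x ≤ birkhoffAvg T f N x) :
    f (T^[N + 1] x) ≤ birkhoffAvg T f N x := by
  have h1 := mul_birkhoffAvg T f (N + 1) x
  rw [Finset.sum_Icc_succ_top (by omega), ← mul_birkhoffAvg] at h1
  push_cast at h1
  have h2 := mul_le_mul_of_nonneg_left h (by positivity : (0 : ℝ) ≤ N + 1)
  linarith

/-- A finite average that bounds all of its terms is equal to each of them. -/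
theorem iterate_eq_birkhoffAvg {N : ℕ} {x : X}
    (h : ∀ k, f (T^[k] x) ≤ birkhoffAvg T f N x) {k : ℕ} (hk : k ∈ Finset.Icc 1 N) :
    f (T^[k] x) = birkhoffAvg T f N x := by
  refine (Finset.sum_eq_sum_iff_of_le fun i _ => h i).1 ?_ k hk
  simp [← mul_birkhoffAvg]

/-- The averages of a function that is not a.e. constant increase infinitely often along almost
every orbit. -/
theorem Ergodic.ae_frequently_birkhoffAvg_lt_succ [MeasurableSpace X] {μ : Measure X}
    [IsFiniteMeasure μ] (hT : Ergodic T μ) (hf : AEMeasurable f μ)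
    (hnc : ¬ ∃ c : ℝ, f =ᵐ[μ] fun _ => c) :
    ∀ᵐ x ∂μ, ∃ᶠ N in atTop, birkhoffAvg T f N x < birkhoffAvg T f (N + 1) x := by
  filter_upwards [hT.ae_forall_ae_le_or_frequently_lt hf,
    hT.ae_forall_ae_le_or_frequently_lt hf.neg,
    hT.quasiMeasurePreserving.ae_forall_iterate_le (f := f)] with x hup hdown hle
  by_contra hx
  obtain ⟨N₀, hN₀⟩ := eventually_atTop.1 (not_frequently.1 hx)
  simp only [not_lt] at hN₀
  have hanti : ∀ n ≥ N₀, ∀ m ≥ n, birkhoffAvg T f m x ≤ birkhoffAvg T f n x := by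
    intro n hn m hm
    induction m, hm using Nat.le_induction with
    | base => exact le_rfl
    | succ m hm ih => exact (hN₀ m (hn.trans hm)).trans ih
  have hess : ∀ n ≥ N₀, ∀ᵐ y ∂μ, f y ≤ birkhoffAvg T f n x := by
    intro n hn
    refine (hup _).resolve_right fun hfr => ?_
    obtain ⟨m, hm, hlt⟩ := frequently_atTop.1 hfr (n + 1)
    obtain ⟨m, rfl⟩ : ∃ j, m = j + 1 := ⟨m - 1, by omega⟩
    have hnm : n ≤ m := by omega
    exact hlt.not_ge
      ((iterate_succ_le_birkhoffAvg (hN₀ m (hn.trans hnm))).trans (hanti n hn m hnm))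
  have heq : ∀ n ≥ N₀, ∀ k ∈ Finset.Icc 1 n, f (T^[k] x) = birkhoffAvg T f n x :=
    fun n hn k hk => iterate_eq_birkhoffAvg (hle _ (hess n hn)) hk
  have hconst : ∀ k ≥ 1, f (T^[k] x) = f (T^[1] x) := fun k hk => by
    rw [heq (N₀ + k) (by omega) k (Finset.mem_Icc.2 (by omega)),
      heq (N₀ + k) (by omega) 1 (Finset.mem_Icc.2 (by omega))]
  have hupper : ∀ᵐ y ∂μ, f y ≤ f (T^[1] x) := by
    rw [heq (N₀ + 1) (by omega) 1 (Finset.mem_Icc.2 (by omega))]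
    exact hess _ (by omega)
  have hlower : ∀ᵐ y ∂μ, (-f) y ≤ -f (T^[1] x) := by
    refine (hdown _).resolve_right fun hfr => ?_
    obtain ⟨k, hk, hlt⟩ := frequently_atTop.1 hfr 1
    simp [hconst k hk] at hlt
  refine hnc ⟨f (T^[1] x), ?_⟩
  filter_upwards [hupper, hlower] with y hy hy'
  exact le_antisymm hy (neg_le_neg_iff.1 hy')

end BirkhoffAvg

theorem stmt_0 {X : Type*} [MeasurableSpace X] (μ : Measure X) [IsProbabilityMeasure μ]
    (T : X → X) (hT : Ergodic T μ) (f : X → ℝ) (hf : Integrable f μ)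
    (hnc : ¬ ∃ c : ℝ, f =ᵐ[μ] fun _ => c) :
    ∀ᵐ x ∂μ,
      (∃ᶠ N in atTop, birkhoffAvg T f (N + 1) x > birkhoffAvg T f N x) ∧
      (∃ᶠ N in atTop, birkhoffAvg T f (N + 1) x < birkhoffAvg T f N x) := by
  have hnc' : ¬ ∃ c : ℝ, -f =ᵐ[μ] fun _ => c := fun ⟨c, hc⟩ =>
    hnc ⟨-c, hc.mono fun y hy => neg_eq_iff_eq_neg.1 hy⟩
  filter_upwards [hT.ae_frequently_birkhoffAvg_lt_succ hf.aemeasurable hnc,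
    hT.ae_frequently_birkhoffAvg_lt_succ hf.aemeasurable.neg hnc'] with x hx hx'
  exact ⟨hx, hx'.mono fun N hN => by simpa only [birkhoffAvg_neg, neg_lt_neg_iff] using hN⟩
end

section
/- Let (N_i)_{i≥1} be a strictly increasing sequence of positive integers with bounded gaps, i.e. sup_i (N_{i+1} − N_i) < ∞. Then there exists a countable set E ⊆ 𝕋 such that for every α ∈ 𝕋 \ E and every real-valued f ∈ L¹(𝕋, λ) that is not a.e. constant, for λ-almost every x ∈ 𝕋 the rotation averages satisfy A_{N_{i+1}} f(x) > A_{N_i} f(x) for infinitely many i and A_{N_{i+1}} f(x) < A_{N_i} f(x) for infinitely many i. -/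
open MeasureTheory Filter

/-- Rotation average `A_N f(x) = (1/N) ∑_{n=1}^N f(x + nα)` on the circle. -/
noncomputable def rotAvg (α : UnitAddCircle) (f : UnitAddCircle → ℝ) (N : ℕ)
    (x : UnitAddCircle) : ℝ :=
  (N : ℝ)⁻¹ * ∑ n ∈ Finset.Icc 1 N, f (x + n • α)

open scoped Topology ComplexConjugate

/-- The weighted exponential average `(1/M) ∑_{n=1}^M w n * z ^ n`. -/
noncomputable def weightedPowAvg (w : ℕ → ℝ) (M : ℕ) (z : ℂ) : ℂ :=
  (M : ℂ)⁻¹ * ∑ n ∈ Finset.Icc 1 M, (w n : ℂ) * z ^ n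

lemma tendsto_weightedPowAvg_one {z : ℂ} (hz : ‖z‖ = 1) (hz1 : z ≠ 1) :
    Tendsto (fun M => weightedPowAvg (fun _ => 1) M z) atTop (𝓝 0) := by
  have hne : z - 1 ≠ 0 := sub_ne_zero.2 hz1
  have hlim : Tendsto (fun M : ℕ => (M : ℝ)⁻¹ * (2 / ‖z - 1‖)) atTop (𝓝 0) := by
    simpa using (tendsto_inv_atTop_nhds_zero_nat (𝕜 := ℝ)).mul_const (2 / ‖z - 1‖)
  refine squeeze_zero_norm (fun M => ?_) hlim
  have hsum : ∑ n ∈ Finset.Icc 1 M, ((1 : ℝ) : ℂ) * z ^ n = z * ((z ^ M - 1) / (z - 1)) := by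
    rw [← geom_sum_eq hz1, Finset.mul_sum, Finset.range_eq_Ico, ← Finset.Ico_succ_right_eq_Icc,
      Finset.sum_Ico_eq_sum_range, ← Finset.range_eq_Ico]
    refine Finset.sum_congr (by simp) fun n _ => ?_
    simp [pow_add]
  rw [weightedPowAvg, hsum]
  simp only [norm_mul, norm_inv, norm_div, hz, one_mul, Complex.norm_natCast]
  gcongr
  calc ‖z ^ M - 1‖ ≤ ‖z ^ M‖ + ‖(1 : ℂ)‖ := norm_sub_le _ _
    _ = 2 := by simp [hz]; norm_num

lemma norm_weightedPowAvg_one_one {M : ℕ} (hM : M ≠ 0) :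
    ‖weightedPowAvg (fun _ => 1) M 1‖ = 1 := by
  simp [weightedPowAvg, hM]

lemma sq_sum_norm_weightedPowAvg_le {w : ℕ → ℝ} (hw : ∀ n, |w n| ≤ 1) (M : ℕ) (s : Finset ℂ) :
    (∑ z ∈ s, ‖weightedPowAvg w M z‖) ^ 2 ≤
      ∑ z ∈ s, ∑ z' ∈ s, ‖weightedPowAvg (fun _ => 1) M (z * conj z')‖ := by
  choose b hb hbc using fun z => RCLike.exists_norm_eq_mul_self (weightedPowAvg w M z)
  set F : ℕ → ℂ := fun n => ∑ z ∈ s, b z * z ^ n with hF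
  have h1 : ((∑ z ∈ s, ‖weightedPowAvg w M z‖ : ℝ) : ℂ) =
      (M : ℂ)⁻¹ * ∑ n ∈ Finset.Icc 1 M, (w n : ℂ) * F n := by
    rw [Complex.ofReal_sum]
    refine (Finset.sum_congr rfl fun z _ => hbc z).trans ?_
    simp only [weightedPowAvg, hF, Finset.mul_sum]
    rw [Finset.sum_comm]
    refine Finset.sum_congr rfl fun n _ => Finset.sum_congr rfl fun z _ => by ring
  have h2 : ∑ z ∈ s, ‖weightedPowAvg w M z‖ ≤ (M : ℝ)⁻¹ * ∑ n ∈ Finset.Icc 1 M, ‖F n‖ := by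
    have h0 : (0 : ℝ) ≤ ∑ z ∈ s, ‖weightedPowAvg w M z‖ := by positivity
    rw [← Complex.norm_of_nonneg h0, h1, norm_mul, norm_inv, Complex.norm_natCast]
    gcongr
    refine (norm_sum_le _ _).trans (Finset.sum_le_sum fun n _ => ?_)
    rw [norm_mul, Complex.norm_real, Real.norm_eq_abs]
    exact mul_le_of_le_one_left (norm_nonneg _) (hw n)
  have h3 : ((M : ℝ)⁻¹ * ∑ n ∈ Finset.Icc 1 M, ‖F n‖) ^ 2 ≤
      (M : ℝ)⁻¹ * ∑ n ∈ Finset.Icc 1 M, ‖F n‖ ^ 2 := by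
    rcases eq_or_ne M 0 with rfl | hM
    · simp
    have hM' : (0 : ℝ) < M := by positivity
    have := sq_sum_le_card_mul_sum_sq (s := Finset.Icc 1 M) (f := fun n => ‖F n‖)
    simp only [Nat.card_Icc, Nat.add_sub_cancel] at this
    rw [mul_pow]
    calc _ ≤ ((M : ℝ)⁻¹) ^ 2 * (M * ∑ n ∈ Finset.Icc 1 M, ‖F n‖ ^ 2) := by gcongr
      _ = _ := by field_simp
  have h4 : (((M : ℝ)⁻¹ * ∑ n ∈ Finset.Icc 1 M, ‖F n‖ ^ 2 : ℝ) : ℂ) =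
      ∑ z ∈ s, ∑ z' ∈ s, b z * conj (b z') * weightedPowAvg (fun _ => 1) M (z * conj z') := by
    push_cast
    simp only [← Complex.mul_conj', hF, map_sum, map_mul, map_pow, Finset.sum_mul_sum,
      weightedPowAvg]
    simp only [Finset.mul_sum]
    rw [Finset.sum_comm]
    refine Finset.sum_congr rfl fun z _ => ?_
    rw [Finset.sum_comm]
    refine Finset.sum_congr rfl fun z' _ => Finset.sum_congr rfl fun n _ => ?_
    push_cast
    ring
  have h5 : (M : ℝ)⁻¹ * ∑ n ∈ Finset.Icc 1 M, ‖F n‖ ^ 2 ≤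
      ∑ z ∈ s, ∑ z' ∈ s, ‖weightedPowAvg (fun _ => 1) M (z * conj z')‖ := by
    have h0 : (0 : ℝ) ≤ (M : ℝ)⁻¹ * ∑ n ∈ Finset.Icc 1 M, ‖F n‖ ^ 2 := by positivity
    rw [← Complex.norm_of_nonneg h0, h4]
    refine (norm_sum_le _ _).trans (Finset.sum_le_sum fun z _ => ?_)
    refine (norm_sum_le _ _).trans (Finset.sum_le_sum fun z' _ => ?_)
    simp [hb]
  calc _ ≤ ((M : ℝ)⁻¹ * ∑ n ∈ Finset.Icc 1 M, ‖F n‖) ^ 2 := by gcongr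
    _ ≤ _ := h3.trans h5

lemma card_mul_sq_le_one_of_le_norm_weightedPowAvg {w : ℕ → ℝ} (hw : ∀ n, |w n| ≤ 1)
    {l : Filter ℕ} [l.NeBot] (hl : l ≤ atTop) {ε : ℝ} (hε : 0 < ε) {s : Finset ℂ}
    (hs : ∀ z ∈ s, ‖z‖ = 1 ∧ ∀ᶠ M in l, ε ≤ ‖weightedPowAvg w M z‖) :
    s.card * ε ^ 2 ≤ 1 := by
  rcases s.eq_empty_or_nonempty with rfl | hne
  · simp
  have hlim : Tendsto (fun M => ∑ z ∈ s, ∑ z' ∈ s,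
      ‖weightedPowAvg (fun _ => 1) M (z * conj z')‖) l
      (𝓝 (∑ z ∈ s, ∑ z' ∈ s, if z = z' then (1 : ℝ) else 0)) := by
    refine tendsto_finsetSum _ fun z hz => tendsto_finsetSum _ fun z' hz' => ?_
    have hz1 := (hs z hz).1
    have hz1' := (hs z' hz').1
    split_ifs with h
    · subst h
      have : z * conj z = 1 := by simp [Complex.mul_conj', hz1]
      rw [this]
      refine tendsto_const_nhds.congr' ?_
      filter_upwards [hl (eventually_ne_atTop 0)] with M hM
      rw [norm_weightedPowAvg_one_one hM]
    · refine tendsto_zero_iff_norm_tendsto_zero.1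
        ((tendsto_weightedPowAvg_one (by simp [hz1, hz1']) fun h1 => h ?_).mono_left hl)
      have h2 : conj z' * z' = 1 := by simp [Complex.conj_mul', hz1']
      calc z = z * (conj z' * z') := by rw [h2, mul_one]
        _ = (z * conj z') * z' := by ring
        _ = z' := by rw [h1, one_mul]
  have hK : ((s.card : ℝ) * ε) ^ 2 ≤ s.card := by
    have : (∑ z ∈ s, ∑ z' ∈ s, if z = z' then (1 : ℝ) else 0) = s.card := by simp
    rw [this] at hlim
    refine ge_of_tendsto hlim ?_
    filter_upwards [(Finset.eventually_all s).2 fun z hz => (hs z hz).2] with M hM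
    refine le_trans ?_ (sq_sum_norm_weightedPowAvg_le hw M s)
    gcongr
    simpa using Finset.sum_le_sum hM
  have hc : (0 : ℝ) < s.card := by exact_mod_cast hne.card_pos
  nlinarith

lemma countable_not_tendsto_weightedPowAvg {w : ℕ → ℝ} (hw : ∀ n, |w n| ≤ 1)
    (U : Ultrafilter ℕ) (hU : (U : Filter ℕ) ≤ atTop) :
    {z : ℂ | ‖z‖ = 1 ∧ ¬ Tendsto (fun M => weightedPowAvg w M z) U (𝓝 0)}.Countable := by
  have hfin : ∀ ε : ℝ, 0 < ε →
      {z : ℂ | ‖z‖ = 1 ∧ ∀ᶠ M in U, ε ≤ ‖weightedPowAvg w M z‖}.Finite := by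
    intro ε hε
    by_contra hinf
    obtain ⟨K, hK⟩ := exists_nat_gt (1 / ε ^ 2)
    obtain ⟨s, hs, rfl⟩ := Set.Infinite.exists_subset_card_eq hinf K
    have := card_mul_sq_le_one_of_le_norm_weightedPowAvg hw hU hε fun z hz => hs hz
    rw [div_lt_iff₀ (by positivity)] at hK
    linarith
  refine (Set.countable_iUnion fun m : ℕ =>
    (hfin (1 / ((m : ℝ) + 1)) (by positivity)).countable).mono ?_
  rintro z ⟨hz, hnot⟩
  rw [Metric.tendsto_nhds] at hnot
  push Not at hnot
  obtain ⟨ε, hε, h⟩ := hnot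
  obtain ⟨m, hm⟩ := exists_nat_one_div_lt hε
  refine Set.mem_iUnion.2 ⟨m, hz, ?_⟩
  filter_upwards [h] with M hM
  rw [dist_zero_right] at hM
  exact hm.le.trans hM

lemma countable_not_tendsto_weightedPowAvg_fourier {w : ℕ → ℝ} (hw : ∀ n, |w n| ≤ 1)
    (U : Ultrafilter ℕ) (hU : (U : Filter ℕ) ≤ atTop) :
    {α : UnitAddCircle | ∃ k : ℤ, k ≠ 0 ∧
      ¬ Tendsto (fun M => weightedPowAvg w M (fourier k α)) U (𝓝 0)}.Countable := by
  have hC := countable_not_tendsto_weightedPowAvg hw U hU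
  refine (Set.countable_iUnion fun k : {k : ℤ // k ≠ 0} => hC.biUnion fun z _ =>
    (?_ : {α : UnitAddCircle | fourier (k : ℤ) α = z}.Countable)).mono ?_
  · obtain ⟨k, hk⟩ := k
    rcases Set.eq_empty_or_nonempty {α : UnitAddCircle | fourier k α = z} with h | ⟨α₀, h₀⟩
    · exact h ▸ Set.countable_empty
    have htor : {u : UnitAddCircle | k.natAbs • u = 0}.Finite :=
      AddCircle.finite_torsion 1 (Int.natAbs_pos.2 hk)
    refine (htor.image (α₀ + ·)).countable.mono fun α (hα : fourier k α = z) => ?_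
    refine (Set.mem_image _ _ _).2 ⟨α - α₀, ?_, by simp⟩
    have h1 : k • α = k • α₀ := by
      apply AddCircle.injective_toCircle one_ne_zero
      apply Subtype.ext
      rw [← fourier_apply, ← fourier_apply]
      exact hα.trans h₀.symm
    rw [Set.mem_ofPred_eq, natAbs_nsmul_eq_zero, smul_sub, h1, sub_self]
  · rintro α ⟨k, hk, hnot⟩
    simp only [Set.mem_iUnion]
    exact ⟨⟨k, hk⟩, fourier k α, ⟨Circle.norm_coe _, hnot⟩, rfl⟩

instance isProbabilityMeasure_volume_unitAddCircle :
    IsProbabilityMeasure (volume : Measure UnitAddCircle) :=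
  ⟨UnitAddCircle.measure_univ⟩

/-- The weighted rotation average `(1/M) ∑_{n=1}^M w n * h (x + nα)` of a complex function. -/
noncomputable def weightedRotAvg (w : ℕ → ℝ) (α : UnitAddCircle) (h : UnitAddCircle → ℂ) (M : ℕ)
    (x : UnitAddCircle) : ℂ :=
  (M : ℂ)⁻¹ * ∑ n ∈ Finset.Icc 1 M, (w n : ℂ) * h (x + n • α)

section WeightedAverages

variable {w : ℕ → ℝ} {α : UnitAddCircle} {h h₁ h₂ : UnitAddCircle → ℂ} {l : Filter ℕ}

lemma MeasureTheory.Integrable.weightedRotAvg (hh : Integrable h) (M : ℕ) :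
    Integrable (weightedRotAvg w α h M) := by
  refine (integrable_finsetSum _ fun n _ => ?_).const_mul _
  exact (hh.comp_add_right _).const_mul _

lemma integral_norm_weightedRotAvg_le (hw : ∀ n, |w n| ≤ 1) (hh : Integrable h) (M : ℕ) :
    ∫ x, ‖weightedRotAvg w α h M x‖ ≤ ∫ x, ‖h x‖ := by
  have hint : ∀ n : ℕ, Integrable fun x => ‖h (x + n • α)‖ := fun n =>
    (hh.comp_add_right (n • α)).norm
  calc ∫ x, ‖weightedRotAvg w α h M x‖
      ≤ ∫ x, (M : ℝ)⁻¹ * ∑ n ∈ Finset.Icc 1 M, ‖h (x + n • α)‖ := by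
        refine integral_mono (hh.weightedRotAvg M).norm
          ((integrable_finsetSum _ fun n _ => hint n).const_mul _) fun x => ?_
        simp only [_root_.weightedRotAvg, norm_mul, norm_inv, Complex.norm_natCast]
        gcongr
        refine (norm_sum_le _ _).trans (Finset.sum_le_sum fun n _ => ?_)
        rw [norm_mul, Complex.norm_real, Real.norm_eq_abs]
        exact mul_le_of_le_one_left (norm_nonneg _) (hw n)
    _ = (M : ℝ)⁻¹ * (M * ∫ x, ‖h x‖) := by
        rw [integral_const_mul, integral_finsetSum _ fun n _ => hint n]
        simp [integral_add_right_eq_self fun x => ‖h x‖]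
    _ ≤ ∫ x, ‖h x‖ := by
        rcases eq_or_ne M 0 with rfl | hM
        · simpa using integral_nonneg fun x => norm_nonneg (h x)
        · rw [inv_mul_cancel_left₀ (by exact_mod_cast hM)]

/-- Convergence in mean to zero of the weighted rotation averages of `h - ∫ h`. -/
def WeightedMeanErgodic (w : ℕ → ℝ) (α : UnitAddCircle) (l : Filter ℕ) (h : UnitAddCircle → ℂ) :
    Prop :=
  Tendsto (fun M => ∫ x, ‖weightedRotAvg w α (fun y => h y - ∫ z, h z) M x‖) l (𝓝 0)

lemma weightedMeanErgodic_const (c : ℂ) : WeightedMeanErgodic w α l fun _ => c := by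
  simp [WeightedMeanErgodic, weightedRotAvg, tendsto_const_nhds]

lemma WeightedMeanErgodic.add (hi₁ : Integrable h₁) (hi₂ : Integrable h₂)
    (hh₁ : WeightedMeanErgodic w α l h₁) (hh₂ : WeightedMeanErgodic w α l h₂) :
    WeightedMeanErgodic w α l (h₁ + h₂) := by
  have hc₁ : Integrable fun y => h₁ y - ∫ z, h₁ z := hi₁.sub (integrable_const _)
  have hc₂ : Integrable fun y => h₂ y - ∫ z, h₂ z := hi₂.sub (integrable_const _)
  have hsum := Tendsto.add hh₁ hh₂
  rw [add_zero] at hsum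
  refine squeeze_zero (fun M => integral_nonneg fun x => norm_nonneg _) (fun M => ?_) hsum
  rw [← integral_add (hc₁.weightedRotAvg M).norm (hc₂.weightedRotAvg M).norm]
  have hc : Integrable fun y => (h₁ + h₂) y - ∫ z, (h₁ + h₂) z :=
    (hi₁.add hi₂).sub (integrable_const _)
  refine integral_mono (hc.weightedRotAvg M).norm
    ((hc₁.weightedRotAvg M).norm.add (hc₂.weightedRotAvg M).norm) fun x => ?_
  refine le_trans (le_of_eq ?_) (norm_add_le _ _)
  simp only [weightedRotAvg, Pi.add_apply]
  rw [integral_add hi₁ hi₂, ← mul_add, ← Finset.sum_add_distrib]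
  congr 2
  exact Finset.sum_congr rfl fun n _ => by ring

lemma WeightedMeanErgodic.const_smul (hh : WeightedMeanErgodic w α l h) (c : ℂ) :
    WeightedMeanErgodic w α l (c • h) := by
  have := Tendsto.const_mul ‖c‖ hh
  rw [mul_zero] at this
  refine this.congr fun M => ?_
  rw [← integral_const_mul]
  congr 1 with x
  rw [← norm_mul]
  simp only [weightedRotAvg, Pi.smul_apply, smul_eq_mul, integral_const_mul, Finset.mul_sum]
  congr 1
  exact Finset.sum_congr rfl fun n _ => by ring

lemma WeightedMeanErgodic.of_approx (hw : ∀ n, |w n| ≤ 1) (hi : Integrable h)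
    (happ : ∀ ε > 0, ∃ g : UnitAddCircle → ℂ, Integrable g ∧ WeightedMeanErgodic w α l g ∧
      ∫ x, ‖h x - g x‖ ≤ ε) : WeightedMeanErgodic w α l h := by
  rw [WeightedMeanErgodic, Metric.tendsto_nhds]
  intro ε hε
  obtain ⟨g, hgi, hg, hgε⟩ := happ (ε / 4) (by positivity)
  rw [WeightedMeanErgodic, Metric.tendsto_nhds] at hg
  filter_upwards [hg (ε / 4) (by positivity)] with M hM
  rw [dist_zero_right, Real.norm_eq_abs,
    abs_of_nonneg (integral_nonneg fun x => norm_nonneg _)] at hM ⊢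
  have hcg : Integrable fun y => g y - ∫ z, g z := hgi.sub (integrable_const _)
  have hch : Integrable fun y => h y - ∫ z, h z := hi.sub (integrable_const _)
  set r : UnitAddCircle → ℂ := fun y => h y - g y with hr
  have hri : Integrable r := hi.sub hgi
  have hcr : Integrable fun y => r y - ∫ z, r z := hri.sub (integrable_const _)
  have h1 : ∫ x, ‖weightedRotAvg w α (fun y => h y - ∫ z, h z) M x‖ ≤
      (∫ x, ‖weightedRotAvg w α (fun y => g y - ∫ z, g z) M x‖) +
        ∫ x, ‖weightedRotAvg w α (fun y => r y - ∫ z, r z) M x‖ := by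
    rw [← integral_add (hcg.weightedRotAvg M).norm (hcr.weightedRotAvg M).norm]
    refine integral_mono (hch.weightedRotAvg M).norm
      ((hcg.weightedRotAvg M).norm.add (hcr.weightedRotAvg M).norm) fun x => ?_
    refine le_trans (le_of_eq ?_) (norm_add_le _ _)
    simp only [weightedRotAvg, hr]
    rw [integral_sub hi hgi, ← mul_add, ← Finset.sum_add_distrib]
    congr 2
    exact Finset.sum_congr rfl fun n _ => by ring
  have h2 : ∫ x, ‖r x - ∫ z, r z‖ ≤ 2 * ∫ x, ‖r x‖ := by
    calc ∫ x, ‖r x - ∫ z, r z‖ ≤ ∫ x, (‖r x‖ + ‖∫ z, r z‖) :=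
          integral_mono hcr.norm (hri.norm.add (integrable_const _)) fun x => norm_sub_le _ _
      _ = (∫ x, ‖r x‖) + ‖∫ z, r z‖ := by
          rw [integral_add hri.norm (integrable_const _)]
          simp
      _ ≤ 2 * ∫ x, ‖r x‖ := by
          linarith [norm_integral_le_integral_norm (μ := volume) r]
  have h3 := integral_norm_weightedRotAvg_le (α := α) hw hcr M
  linarith

lemma weightedMeanErgodic_fourier
    (hα : ∀ k : ℤ, k ≠ 0 → Tendsto (fun M => weightedPowAvg w M (fourier k α)) l (𝓝 0)) (k : ℤ) :
    WeightedMeanErgodic w α l (fourier k : C(UnitAddCircle, ℂ)) := by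
  rcases eq_or_ne k 0 with rfl | hk
  · have : ((fourier 0 : C(UnitAddCircle, ℂ)) : UnitAddCircle → ℂ) = fun _ => 1 := by
      ext x
      exact fourier_zero
    rw [this]
    exact weightedMeanErgodic_const 1
  have h0 : ∫ z, (fourier k : C(UnitAddCircle, ℂ)) z = 0 := by
    have := integral_eq_zero_of_add_right_eq_neg (μ := (volume : Measure UnitAddCircle))
      (fourier_add_half_inv_index hk one_pos)
    simpa using this
  have hnorm := (hα k hk).norm
  rw [norm_zero] at hnorm
  refine hnorm.congr fun M => ?_
  have : ∀ x, ‖weightedRotAvg w α (fun y => (fourier k : C(UnitAddCircle, ℂ)) y -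
      ∫ z, (fourier k : C(UnitAddCircle, ℂ)) z) M x‖ = ‖weightedPowAvg w M (fourier k α)‖ := by
    intro x
    have hx : ‖(fourier k x : ℂ)‖ = 1 := Circle.norm_coe _
    rw [h0]
    refine Eq.trans ?_ ((norm_mul _ _).trans ((congrArg _ hx).trans (mul_one _)))
    simp only [weightedRotAvg, weightedPowAvg, sub_zero, mul_assoc, Finset.sum_mul]
    congr 2
    refine Finset.sum_congr rfl fun n _ => ?_
    simp only [fourier_apply, smul_add, AddCircle.toCircle_add, smul_comm k n,
      AddCircle.toCircle_nsmul]
    push_cast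
    ring
  rw [integral_congr_ae (Eventually.of_forall this)]
  simp

/-- A weighted mean ergodic theorem for rotations, under the assumption that the weights are
asymptotically orthogonal to the nontrivial characters evaluated along the rotation. -/
lemma weightedMeanErgodic_of_integrable (hw : ∀ n, |w n| ≤ 1)
    (hα : ∀ k : ℤ, k ≠ 0 → Tendsto (fun M => weightedPowAvg w M (fourier k α)) l (𝓝 0))
    (hi : Integrable h) : WeightedMeanErgodic w α l h := by
  have hci : ∀ g : C(UnitAddCircle, ℂ), Integrable g := fun g =>
    g.continuous.integrable_of_hasCompactSupport (HasCompactSupport.of_compactSpace _)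
  have hspan : ∀ g ∈ Submodule.span ℂ (Set.range (fourier : ℤ → C(UnitAddCircle, ℂ))),
      WeightedMeanErgodic w α l g := by
    intro g hg
    induction hg using Submodule.span_induction with
    | mem g hg =>
      obtain ⟨k, rfl⟩ := hg
      exact weightedMeanErgodic_fourier hα k
    | zero => exact weightedMeanErgodic_const 0
    | add g₁ g₂ _ _ h₁ h₂ => exact h₁.add (hci g₁) (hci g₂) h₂
    | smul c g _ hg => exact hg.const_smul c
  have hcont : ∀ g : C(UnitAddCircle, ℂ), WeightedMeanErgodic w α l g := by
    intro g
    refine WeightedMeanErgodic.of_approx hw (hci g) fun ε hε => ?_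
    have hmem : g ∈ (Submodule.span ℂ
        (Set.range (fourier : ℤ → C(UnitAddCircle, ℂ)))).topologicalClosure := by
      rw [span_fourier_closure_eq_top]
      trivial
    obtain ⟨p, hp, hpε⟩ := Metric.mem_closure_iff.1 hmem ε hε
    refine ⟨p, hci p, hspan p hp, ?_⟩
    calc ∫ x, ‖g x - p x‖ ≤ ∫ _ : UnitAddCircle, ε := by
          refine integral_mono ((hci g).sub (hci p)).norm (integrable_const _) fun x => ?_
          rw [← dist_eq_norm]
          exact (ContinuousMap.dist_apply_le_dist x).trans hpε.le
      _ = ε := by simp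
  refine WeightedMeanErgodic.of_approx hw hi fun ε hε => ?_
  obtain ⟨g, hg, hgi⟩ := hi.exists_boundedContinuous_integral_sub_le hε
  exact ⟨g, hgi, hcont g.toContinuousMap, hg⟩

end WeightedAverages

open Classical in
/-- The indicator of the terms of `N` that are followed by a gap of length `d`. -/
noncomputable def gapWeight (N : ℕ → ℕ) (d n : ℕ) : ℝ :=
  if ∃ i, N i = n ∧ N (i + 1) = n + d then 1 else 0

lemma gapWeight_nonneg (N : ℕ → ℕ) (d n : ℕ) : 0 ≤ gapWeight N d n := by
  unfold gapWeight
  split_ifs <;> norm_num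

lemma abs_gapWeight_le_one (N : ℕ → ℕ) (d n : ℕ) : |gapWeight N d n| ≤ 1 := by
  unfold gapWeight
  split_ifs <;> norm_num

lemma le_sum_gapWeight {N : ℕ → ℕ} (hmono : StrictMono N) (hpos : ∀ i, 1 ≤ N i) {B : ℕ}
    (hB : ∀ i, N (i + 1) - N i ≤ B) (i : ℕ) :
    (i + 1 : ℝ) ≤ ∑ d ∈ Finset.Icc 1 B, ∑ n ∈ Finset.Icc 1 (N i), gapWeight N d n := by
  rw [Finset.sum_comm]
  have hsub : (Finset.range (i + 1)).image N ⊆ Finset.Icc 1 (N i) := by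
    intro n hn
    obtain ⟨j, hj, rfl⟩ := Finset.mem_image.1 hn
    exact Finset.mem_Icc.2 ⟨hpos j, hmono.monotone (Nat.lt_succ_iff.1 (Finset.mem_range.1 hj))⟩
  calc (i + 1 : ℝ) = ∑ n ∈ (Finset.range (i + 1)).image N, (1 : ℝ) := by
        simp [Finset.card_image_of_injective _ hmono.injective]
    _ ≤ ∑ n ∈ (Finset.range (i + 1)).image N, ∑ d ∈ Finset.Icc 1 B, gapWeight N d n := by
        refine Finset.sum_le_sum fun n hn => ?_
        obtain ⟨j, -, rfl⟩ := Finset.mem_image.1 hn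
        have hlt := hmono (Nat.lt_succ_self j)
        have hmem : N (j + 1) - N j ∈ Finset.Icc 1 B :=
          Finset.mem_Icc.2 ⟨Nat.sub_pos_of_lt hlt, hB j⟩
        refine le_trans (le_of_eq ?_)
          (Finset.single_le_sum (fun d _ => gapWeight_nonneg N d (N j)) hmem)
        rw [gapWeight, if_pos ⟨j, rfl, (Nat.add_sub_cancel' hlt.le).symm⟩]
    _ ≤ _ := Finset.sum_le_sum_of_subset_of_nonneg hsub fun n _ _ =>
        Finset.sum_nonneg fun d _ => gapWeight_nonneg N d n

lemma exists_eventually_le_average_gapWeight {N : ℕ → ℕ} (hmono : StrictMono N)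
    (hpos : ∀ i, 1 ≤ N i) {B : ℕ} (hB : ∀ i, N (i + 1) - N i ≤ B) (V : Ultrafilter ℕ) :
    ∃ d, 1 ≤ d ∧ ∃ ε : ℝ, 0 < ε ∧
      ∀ᶠ i in V, ε ≤ (N i : ℝ)⁻¹ * ∑ n ∈ Finset.Icc 1 (N i), gapWeight N d n := by
  have hB1 : 1 ≤ B := (Nat.sub_pos_of_lt (hmono (Nat.lt_succ_self 0))).trans_le (hB 0)
  have hB0 : (0 : ℝ) < B := by exact_mod_cast hB1
  have hgrow : ∀ i, N i ≤ (N 0 + B) * (i + 1) := by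
    intro i
    induction i with
    | zero => simp
    | succ i ih =>
      nlinarith [Nat.le_add_of_sub_le (hB i)]
  set ε : ℝ := 1 / ((N 0 + B) * B) with hε
  have hε0 : 0 < ε := by positivity
  have hex : ∀ i, ∃ d ∈ Finset.Icc 1 B,
      ε ≤ (N i : ℝ)⁻¹ * ∑ n ∈ Finset.Icc 1 (N i), gapWeight N d n := by
    intro i
    have hNi : (0 : ℝ) < N i := by exact_mod_cast hpos i
    refine Finset.exists_le_of_sum_le (Finset.nonempty_Icc.2 hB1) ?_
    rw [← Finset.mul_sum]
    have hg : (N i : ℝ) ≤ (N 0 + B) * (i + 1) := by exact_mod_cast hgrow i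
    calc ∑ d ∈ Finset.Icc 1 B, ε = 1 / (N 0 + B) := by
          simp [hε]
          field_simp
      _ ≤ (N i : ℝ)⁻¹ * (i + 1) := by
          rw [div_le_iff₀ (by positivity), mul_assoc, inv_mul_eq_div, le_div_iff₀ hNi]
          linarith
      _ ≤ _ := by
          gcongr
          exact le_sum_gapWeight hmono hpos hB i
  obtain ⟨d, hd, h⟩ := (Ultrafilter.eventually_exists_mem_iff (Finset.finite_toSet _)).1
    (Eventually.of_forall (f := (V : Filter ℕ)) hex)
  exact ⟨d, (Finset.mem_Icc.1 hd).1, ε, hε0, h⟩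

lemma sum_Icc_one_eq_sum_range {β : Type*} [AddCommMonoid β] (v : ℕ → β) (M : ℕ) :
    ∑ n ∈ Finset.Icc 1 M, v n = ∑ n ∈ Finset.range M, v (n + 1) := by
  rw [Finset.range_eq_Ico, Finset.sum_Ico_add' v 0 M 1]
  rfl

lemma tendsto_inv_mul_sum_Icc {v : ℕ → ℝ} (hv : Tendsto v atTop (𝓝 0)) :
    Tendsto (fun M : ℕ => (M : ℝ)⁻¹ * ∑ n ∈ Finset.Icc 1 M, v n) atTop (𝓝 0) := by
  refine ((tendsto_add_atTop_iff_nat 1).2 hv).cesaro.congr fun M => ?_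
  rw [sum_Icc_one_eq_sum_range]

section Rotation

variable {α : UnitAddCircle} {f : UnitAddCircle → ℝ}

lemma natCast_mul_rotAvg (α : UnitAddCircle) (f : UnitAddCircle → ℝ) (M : ℕ) (x : UnitAddCircle) :
    (M : ℝ) * rotAvg α f M x = ∑ n ∈ Finset.Icc 1 M, f (x + n • α) := by
  rcases eq_or_ne M 0 with rfl | hM
  · simp
  · rw [rotAvg, mul_inv_cancel_left₀ (by exact_mod_cast hM)]

lemma sum_block_eq (α : UnitAddCircle) (f : UnitAddCircle → ℝ) (n d : ℕ) (x : UnitAddCircle) :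
    ∑ k ∈ Finset.Icc 1 d, f (x + n • α + k • α) =
      ((n + d : ℕ) : ℝ) * rotAvg α f (n + d) x - n * rotAvg α f n x := by
  rw [natCast_mul_rotAvg, natCast_mul_rotAvg, eq_sub_iff_add_eq, add_comm]
  rw [sum_Icc_one_eq_sum_range, sum_Icc_one_eq_sum_range, sum_Icc_one_eq_sum_range,
    Finset.sum_range_add]
  congr 1
  refine Finset.sum_congr rfl fun k _ => ?_
  rw [add_assoc x, ← add_smul, add_assoc n]

lemma norm_weightedRotAvg_sub_integral (w : ℕ → ℝ) (α : UnitAddCircle) (f : UnitAddCircle → ℝ)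
    (M : ℕ) (x : UnitAddCircle) :
    ‖weightedRotAvg w α (fun y => (f y : ℂ) - ∫ z, (f z : ℂ)) M x‖ =
      |(M : ℝ)⁻¹ * ∑ n ∈ Finset.Icc 1 M, w n * f (x + n • α) -
        ((M : ℝ)⁻¹ * ∑ n ∈ Finset.Icc 1 M, w n) * ∫ z, f z| := by
  rw [integral_complex_ofReal, ← Real.norm_eq_abs, ← Complex.norm_real, weightedRotAvg]
  push_cast
  rw [mul_assoc, ← mul_sub, Finset.sum_mul, ← Finset.sum_sub_distrib]
  simp only [mul_sub]

lemma addOrderOf_eq_zero_of_tendsto_weightedPowAvg {l : Filter ℕ} [l.NeBot] (hl : l ≤ atTop)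
    (hα : ∀ k : ℤ, k ≠ 0 →
      Tendsto (fun M => weightedPowAvg (fun _ => 1) M (fourier k α)) l (𝓝 0)) :
    addOrderOf α = 0 := by
  rw [addOrderOf_eq_zero_iff']
  intro n hn h0
  have hlim := (hα n (by exact_mod_cast hn.ne')).norm
  have h1 : (fourier (n : ℤ) α : ℂ) = 1 := by
    rw [fourier_apply, natCast_zsmul, h0, AddCircle.toCircle_zero, Circle.coe_one]
  rw [h1, norm_zero] at hlim
  refine one_ne_zero (tendsto_nhds_unique (tendsto_const_nhds.congr' ?_) hlim)
  filter_upwards [hl (eventually_ne_atTop 0)] with M hM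
  rw [norm_weightedPowAvg_one_one hM]

/-- If all block sums of length `d` of `f` coincide almost everywhere, `f` is constant. -/
lemma exists_ae_eq_const_of_block_sum_ae_eq (hα : addOrderOf α = 0) (hf : Integrable f) {d : ℕ}
    (hd : 1 ≤ d) {c : ℝ} (h : ∀ᵐ x : UnitAddCircle, ∑ k ∈ Finset.Icc 1 d, f (x + k • α) = c) :
    ∃ c : ℝ, f =ᵐ[volume] fun _ => c := by
  have hmp : ∀ a : UnitAddCircle,
      MeasurePreserving (fun x : UnitAddCircle => x + a) volume volume :=
    fun a => measurePreserving_add_right volume a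
  have hshift : ∀ᵐ x : UnitAddCircle, ∑ k ∈ Finset.Icc 1 d, f (x + α + k • α) = c := by
    have h' := (hmp α).quasiMeasurePreserving.tendsto_ae.eventually h
    exact h'
  have hinv' : ∀ᵐ x, f (x + α + d • α) = f (x + α) := by
    filter_upwards [h, hshift] with x h₁ h₂
    rw [sum_Icc_one_eq_sum_range] at h₁ h₂
    have h₃ := (Finset.sum_range_succ (fun k => f (x + (k + 1) • α)) d).symm.trans
      (Finset.sum_range_succ' (fun k => f (x + (k + 1) • α)) d)
    have h₄ : ∀ k : ℕ, x + α + k • α = x + (k + 1) • α := fun k => by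
      rw [add_smul, one_smul, add_comm (k • α), add_assoc]
    simp only [h₄] at h₂ ⊢
    rw [h₁, h₂] at h₃
    simpa using h₃
  have hinv : ∀ᵐ x, f (x + d • α) = f x := by
    have := (hmp (-α)).quasiMeasurePreserving.tendsto_ae.eventually
      hinv'
    filter_upwards [this] with x hx
    simpa using hx
  have herg : Ergodic (fun x : UnitAddCircle => x + d • α) := by
    rw [AddCircle.ergodic_add_right, addOrderOf_eq_zero_iff']
    intro n hn
    rw [smul_smul]
    exact addOrderOf_eq_zero_iff'.1 hα _ (by positivity)
  exact herg.ae_eq_const_of_ae_eq_comp₀ hf.aemeasurable.nullMeasurable hinv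

end Rotation

section MainArgument

variable {N : ℕ → ℕ} {α : UnitAddCircle} {f : UnitAddCircle → ℝ}

lemma tendsto_weight_mul_posPart {d : ℕ} (hd : 1 ≤ d) (hmono : StrictMono N) {m : ℝ}
    {x : UnitAddCircle}
    (hdec : ∀ᶠ i in atTop, rotAvg α f (N (i + 1)) x ≤ rotAvg α f (N i) x)
    (hlim : Tendsto (fun i => rotAvg α f (N i) x) atTop (𝓝 m)) :
    Tendsto (fun n => gapWeight N d n *
      max (∑ k ∈ Finset.Icc 1 d, f (x + n • α + k • α) - d * m) 0) atTop (𝓝 0) := by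
  have hd0 : (0 : ℝ) < d := by exact_mod_cast hd
  rw [Metric.tendsto_nhds]
  intro e he
  have hclose : ∀ᶠ i in atTop, |rotAvg α f (N i) x - m| < e / d :=
    Metric.tendsto_nhds.1 hlim _ (by positivity)
  obtain ⟨J, hJ⟩ := eventually_atTop.1 (hdec.and hclose)
  filter_upwards [eventually_ge_atTop (N J)] with n hn
  rw [dist_zero_right, Real.norm_eq_abs, gapWeight]
  split_ifs with h
  · obtain ⟨i, rfl, hi⟩ := h
    obtain ⟨h₁, h₂⟩ := hJ i (hmono.le_iff_le.1 hn)
    rw [one_mul, abs_of_nonneg (le_max_right _ _), max_lt_iff, sum_block_eq, ← hi]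
    refine ⟨?_, he⟩
    have h₃ := (lt_div_iff₀ hd0).1 ((le_abs_self _).trans_lt h₂)
    have h₄ : (N (i + 1) : ℝ) = N i + d := by exact_mod_cast hi
    have h₅ := mul_le_mul_of_nonneg_left h₁ (Nat.cast_nonneg (α := ℝ) (N (i + 1)))
    rw [h₄] at h₅ ⊢
    linarith
  · simpa using he

lemma integral_posPart_block_sum_pos (hα : addOrderOf α = 0) (hf : Integrable f)
    (hnc : ¬ ∃ c : ℝ, f =ᵐ[volume] fun _ => c) {d : ℕ} (hd : 1 ≤ d) :
    0 < ∫ x, max (∑ k ∈ Finset.Icc 1 d, f (x + k • α) - d * ∫ z, f z) 0 := by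
  set g : UnitAddCircle → ℝ := fun x => ∑ k ∈ Finset.Icc 1 d, f (x + k • α) - d * ∫ z, f z with hg
  have hfk : ∀ k : ℕ, Integrable fun x => f (x + k • α) := fun k => hf.comp_add_right (k • α)
  have hsum : Integrable fun x => ∑ k ∈ Finset.Icc 1 d, f (x + k • α) :=
    integrable_finsetSum _ fun k _ => hfk k
  have hgi : Integrable g := hsum.sub (integrable_const _)
  have hg0 : ∫ x, g x = 0 := by
    rw [hg, integral_sub hsum (integrable_const _), integral_finsetSum _ fun k _ => hfk k]
    simp [integral_add_right_eq_self f]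
  have hnn : 0 ≤ fun x => max (g x) 0 := fun x => le_max_right _ _
  refine lt_of_le_of_ne (integral_nonneg hnn) fun h0 => hnc ?_
  have hpos : ∀ᵐ x, max (g x) 0 = 0 :=
    (integral_eq_zero_iff_of_nonneg hnn hgi.pos_part).1 h0.symm
  have hneg : (fun x => - g x) =ᵐ[volume] 0 := by
    refine (integral_eq_zero_iff_of_nonneg_ae ?_ hgi.neg).1
      ((integral_neg g).trans (by rw [hg0, neg_zero]))
    filter_upwards [hpos] with x hx
    have := le_max_left (g x) 0
    rw [hx] at this
    simpa using this
  refine exists_ae_eq_const_of_block_sum_ae_eq hα hf hd (c := d * ∫ z, f z) ?_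
  filter_upwards [hneg] with x hx
  exact sub_eq_zero.1 (neg_eq_zero.1 hx)

lemma exists_seq_tendsto_ae_of_tendsto_integral_norm {Ω : Type*} [MeasurableSpace Ω]
    {μ : Measure Ω} {l : Filter ℕ} [l.NeBot] (hl : l ≤ atTop) {F : ℕ → Ω → ℝ}
    (hF : ∀ M, Integrable (F M) μ) (hlim : Tendsto (fun M => ∫ x, ‖F M x‖ ∂μ) l (𝓝 0))
    {p : ℕ → Prop} (hp : ∀ᶠ M in l, p M) :
    ∃ ψ : ℕ → ℕ, StrictMono ψ ∧ (∀ j, p (ψ j)) ∧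
      ∀ᵐ x ∂μ, Tendsto (fun j => F (ψ j) x) atTop (𝓝 0) := by
  have hfreq : ∀ n : ℕ, ∃ᶠ M in atTop, p M ∧ ∫ x, ‖F M x‖ ∂μ ≤ 1 / ((n : ℝ) + 1) := by
    intro n
    refine Frequently.filter_mono (Eventually.frequently ?_) hl
    exact hp.and (hlim.eventually_le_const (by positivity))
  obtain ⟨φ, hφ, hφp⟩ := extraction_forall_of_frequently hfreq
  have hmeas : TendstoInMeasure μ (fun n => F (φ n)) atTop (fun _ => 0) := by
    refine tendstoInMeasure_of_tendsto_eLpNorm one_ne_zero (fun n => (hF _).aestronglyMeasurable)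
      aestronglyMeasurable_const ?_
    have h0 : Tendsto (fun n => ENNReal.ofReal (∫ x, ‖F (φ n) x‖ ∂μ)) atTop (𝓝 0) := by
      rw [← ENNReal.ofReal_zero]
      exact (ENNReal.continuous_ofReal.tendsto 0).comp
        (squeeze_zero (fun n => integral_nonneg fun x => norm_nonneg _) (fun n => (hφp n).2)
          tendsto_one_div_add_atTop_nhds_zero_nat)
    refine h0.congr fun n => ?_
    rw [ofReal_integral_norm_eq_lintegral_enorm (hF _), eLpNorm_one_eq_lintegral_enorm]
    simp
  obtain ⟨ns, hns, hae⟩ := hmeas.exists_seq_tendsto_ae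
  exact ⟨φ ∘ ns, hφ.comp hns, fun j => (hφp _).1, hae⟩

lemma tendsto_rotAvg_of_eventually_le {m : ℝ} {x : UnitAddCircle}
    (hdec : ∀ᶠ i in atTop, rotAvg α f (N (i + 1)) x ≤ rotAvg α f (N i) x)
    {κ : ℕ → ℕ} (hκ : Tendsto κ atTop atTop)
    (hlim : Tendsto (fun j => rotAvg α f (N (κ j)) x) atTop (𝓝 m)) :
    Tendsto (fun i => rotAvg α f (N i) x) atTop (𝓝 m) := by
  obtain ⟨I, hI⟩ := eventually_atTop.1 hdec
  have hanti : Antitone fun i => rotAvg α f (N (i + I)) x :=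
    antitone_nat_of_succ_le fun i => by
      have := hI (i + I) (Nat.le_add_left I i)
      rwa [add_right_comm] at this
  rw [← tendsto_add_atTop_iff_nat I,
    tendsto_iff_tendsto_subseq_of_antitone hanti ((tendsto_sub_atTop_nat I).comp hκ)]
  refine hlim.congr' ?_
  filter_upwards [hκ.eventually_ge_atTop I] with j hj
  simp [Nat.sub_add_cancel hj]

lemma ae_frequently_rotAvg_lt (hmono : StrictMono N) {l : Filter ℕ} [l.NeBot] (hl : l ≤ atTop)
    (hNl : ∀ᶠ M in l, M ∈ Set.range N) {d : ℕ} (hd : 1 ≤ d) {ε : ℝ} (hε : 0 < ε)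
    (hdens : ∀ᶠ M : ℕ in l, ε ≤ (M : ℝ)⁻¹ * ∑ n ∈ Finset.Icc 1 M, gapWeight N d n)
    (hα : ∀ k : ℤ, k ≠ 0 →
      Tendsto (fun M => weightedPowAvg (fun _ => 1) M (fourier k α)) l (𝓝 0))
    (hα' : ∀ k : ℤ, k ≠ 0 →
      Tendsto (fun M => weightedPowAvg (gapWeight N d) M (fourier k α)) l (𝓝 0))
    (hf : Integrable f) (hnc : ¬ ∃ c : ℝ, f =ᵐ[volume] fun _ => c) :
    ∀ᵐ x, ∃ᶠ i in atTop, rotAvg α f (N i) x < rotAvg α f (N (i + 1)) x := by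
  have hord := addOrderOf_eq_zero_of_tendsto_weightedPowAvg hl hα
  set m := ∫ z, f z with hm
  set gp : UnitAddCircle → ℝ :=
    fun x => max (∑ k ∈ Finset.Icc 1 d, f (x + k • α) - d * m) 0 with hgp
  have hQ : 0 < ∫ x, gp x := integral_posPart_block_sum_pos hord hf hnc hd
  have hgpi : Integrable gp :=
    ((integrable_finsetSum _ fun k _ => hf.comp_add_right (k • α)).sub
      (integrable_const _)).pos_part
  have h₁ := weightedMeanErgodic_of_integrable (by simp) hα hf.ofReal
  have h₂ := weightedMeanErgodic_of_integrable (abs_gapWeight_le_one N d) hα' hgpi.ofReal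
  set F₁ := fun (M : ℕ) x =>
    ‖weightedRotAvg (fun _ => 1) α (fun y => (f y : ℂ) - ∫ z, (f z : ℂ)) M x‖ with hF₁
  set F₂ := fun (M : ℕ) x =>
    ‖weightedRotAvg (gapWeight N d) α (fun y => (gp y : ℂ) - ∫ z, (gp z : ℂ)) M x‖ with hF₂
  have hi₁ : ∀ M, Integrable (F₁ M) := fun M =>
    ((hf.ofReal.sub (integrable_const _)).weightedRotAvg M).norm
  have hi₂ : ∀ M, Integrable (F₂ M) := fun M =>
    ((hgpi.ofReal.sub (integrable_const _)).weightedRotAvg M).norm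
  have hnn₁ : ∀ M x, 0 ≤ F₁ M x := fun M x => norm_nonneg _
  have hnn₂ : ∀ M x, 0 ≤ F₂ M x := fun M x => norm_nonneg _
  have hlim : Tendsto (fun M => ∫ x, ‖F₁ M x + F₂ M x‖) l (𝓝 0) := by
    have := Tendsto.add h₁ h₂
    rw [add_zero] at this
    refine this.congr fun M => ?_
    refine (integral_add (hi₁ M) (hi₂ M)).symm.trans
      (integral_congr_ae (Eventually.of_forall fun x => ?_))
    exact (Real.norm_of_nonneg (add_nonneg (hnn₁ M x) (hnn₂ M x))).symm
  obtain ⟨ψ, hψ, hψp, hae⟩ := exists_seq_tendsto_ae_of_tendsto_integral_norm hl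
    (F := fun M x => F₁ M x + F₂ M x) (fun M => (hi₁ M).add (hi₂ M)) hlim
    ((hNl.and hdens).and (hl (eventually_ne_atTop 0)))
  filter_upwards [hae] with x hx
  by_contra hnot
  have hdec : ∀ᶠ i in atTop, rotAvg α f (N (i + 1)) x ≤ rotAvg α f (N i) x := by
    simpa [not_frequently] using hnot
  choose κ hκ using fun j => (hψp j).1.1
  have hκmono : StrictMono κ := fun a b hab => hmono.lt_iff_lt.1 (by
    rw [hκ, hκ]
    exact hψ hab)
  have hx₁ : Tendsto (fun j => rotAvg α f (N (κ j)) x) atTop (𝓝 m) := by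
    rw [← tendsto_sub_nhds_zero_iff]
    refine squeeze_zero_norm (fun j => ?_) hx
    refine le_trans (le_of_eq ?_) (le_add_of_nonneg_right (hnn₂ _ x))
    have hne : (ψ j : ℝ) ≠ 0 := by exact_mod_cast (hψp j).2
    simp only [hF₁]
    rw [norm_weightedRotAvg_sub_integral, hκ, Real.norm_eq_abs, rotAvg, hm]
    simp [hne]
  have hx₂ : Tendsto (fun j => (ψ j : ℝ)⁻¹ * ∑ n ∈ Finset.Icc 1 (ψ j),
      gapWeight N d n * gp (x + n • α) - ((ψ j : ℝ)⁻¹ * ∑ n ∈ Finset.Icc 1 (ψ j),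
      gapWeight N d n) * ∫ z, gp z) atTop (𝓝 0) := by
    refine squeeze_zero_norm (fun j => ?_) hx
    refine le_trans (le_of_eq ?_) (le_add_of_nonneg_left (hnn₁ _ x))
    simp only [hF₂]
    rw [norm_weightedRotAvg_sub_integral, Real.norm_eq_abs]
  have hA := tendsto_rotAvg_of_eventually_le hdec hκmono.tendsto_atTop hx₁
  have hces := (tendsto_inv_mul_sum_Icc (tendsto_weight_mul_posPart hd hmono hdec hA)).comp
    hψ.tendsto_atTop
  have hprod := hces.sub hx₂
  rw [sub_zero] at hprod
  have hle : ε * ∫ z, gp z ≤ 0 := by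
    refine ge_of_tendsto' hprod fun j => ?_
    have := mul_le_mul_of_nonneg_right (hψp j).1.2 hQ.le
    simpa [hgp] using this
  exact absurd (mul_pos hε hQ) hle.not_gt

end MainArgument

lemma rotAvg_neg (α : UnitAddCircle) (f : UnitAddCircle → ℝ) (M : ℕ) (x : UnitAddCircle) :
    rotAvg α (fun y => - f y) M x = - rotAvg α f M x := by
  simp [rotAvg]

theorem stmt_5 (N : ℕ → ℕ) (hmono : StrictMono N) (hpos : ∀ i, 1 ≤ N i)
    (hgap : ∃ B : ℕ, ∀ i, N (i + 1) - N i ≤ B) :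
    ∃ E : Set UnitAddCircle, E.Countable ∧
      ∀ α : UnitAddCircle, α ∉ E →
        ∀ f : UnitAddCircle → ℝ, Integrable f volume →
          (¬ ∃ c : ℝ, f =ᵐ[(volume : Measure UnitAddCircle)] fun _ => c) →
          ∀ᵐ x ∂(volume : Measure UnitAddCircle),
            (∃ᶠ i in atTop, rotAvg α f (N (i + 1)) x > rotAvg α f (N i) x) ∧
            (∃ᶠ i in atTop, rotAvg α f (N (i + 1)) x < rotAvg α f (N i) x) := by
  obtain ⟨B, hB⟩ := hgap
  set U : Ultrafilter ℕ := (hyperfilter ℕ).map N with hUdef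
  have hU : (U : Filter ℕ) ≤ atTop := by
    rw [hUdef, Ultrafilter.coe_map]
    exact hmono.tendsto_atTop.mono_left Nat.hyperfilter_le_atTop
  obtain ⟨d, hd, ε, hε, hdens⟩ :=
    exists_eventually_le_average_gapWeight hmono hpos hB (hyperfilter ℕ)
  have hNU : ∀ᶠ M in (U : Filter ℕ), M ∈ Set.range N := by
    rw [hUdef, Ultrafilter.coe_map, eventually_map]
    exact Eventually.of_forall fun i => ⟨i, rfl⟩
  have hdensU : ∀ᶠ M : ℕ in (U : Filter ℕ),
      ε ≤ (M : ℝ)⁻¹ * ∑ n ∈ Finset.Icc 1 M, gapWeight N d n := by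
    rw [hUdef, Ultrafilter.coe_map, eventually_map]
    exact hdens
  refine ⟨_, (countable_not_tendsto_weightedPowAvg_fourier (w := fun _ => 1) (by simp) U hU).union
    (countable_not_tendsto_weightedPowAvg_fourier (abs_gapWeight_le_one N d) U hU),
    fun α hα f hf hnc => ?_⟩
  simp only [Set.mem_union, Set.mem_ofPred_eq, not_or, not_exists, not_and, not_not] at hα
  have hnc' : ¬ ∃ c : ℝ, (fun y => - f y) =ᵐ[volume] fun _ => c := by
    rintro ⟨c, hc⟩
    refine hnc ⟨-c, ?_⟩
    filter_upwards [hc] with y hy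
    rw [← hy, neg_neg]
  filter_upwards [ae_frequently_rotAvg_lt hmono hU hNU hd hε hdensU hα.1 hα.2 hf hnc,
    ae_frequently_rotAvg_lt hmono hU hNU hd hε hdensU hα.1 hα.2 hf.neg hnc'] with x h₁ h₂
  refine ⟨h₁, h₂.mono fun i hi => ?_⟩
  change rotAvg α (fun y => - f y) _ x < rotAvg α (fun y => - f y) _ x at hi
  rw [rotAvg_neg, rotAvg_neg] at hi
  exact neg_lt_neg_iff.1 hi
end

section
/- Fix a real number p with 1 ≤ p < ∞. Let (φ_n) be a proper approximate identity on ℝ and let (ε_n) be a sequence of positive reals with ε_n → 0. Then there exists a dense Gδ subset 𝒜 of L^p(ℝ) such that for every f ∈ 𝒜, one has limsup_{n→∞} (φ_n ⋆ f(x) − f(x))/ε_n = +∞ for Lebesgue-almost every x ∈ ℝ, and liminf_{n→∞} (φ_n ⋆ f(x) − f(x))/ε_n = −∞ for Lebesgue-almost every x ∈ ℝ. -/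
open MeasureTheory Filter

/-- Convolution `φ ⋆ f (x) = ∫ φ(y) f(x − y) dy` on the real line. -/
noncomputable def convR (φ f : ℝ → ℝ) (x : ℝ) : ℝ := ∫ y, φ y * f (x - y)

/-- A proper approximate identity: nonnegative functions of `L¹`-norm one and bounded
support, eventually supported in arbitrarily small neighborhoods of `0`, such that
`φ_n ⋆ g → g` in `L¹`-norm for every `g ∈ L¹(ℝ)`. -/
structure IsProperApproxIdentity (φ : ℕ → ℝ → ℝ) : Prop where
  integrable : ∀ n, Integrable (φ n) volume
  nonneg : ∀ n y, 0 ≤ φ n y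
  norm_one : ∀ n, ∫ y, |φ n y| = 1
  bddSupport : ∀ n, ∃ R : ℝ, ∀ y : ℝ, R ≤ |y| → φ n y = 0
  eventuallyLocal : ∀ δ : ℝ, 0 < δ → ∃ N : ℕ, ∀ n ≥ N,
    ∀ᵐ y ∂(volume : Measure ℝ), y ∉ Set.Icc (-δ) δ → φ n y = 0
  approxId : ∀ g : ℝ → ℝ, Integrable g volume →
    Tendsto (fun n => ∫ x, |convR (φ n) g x - g x|) atTop (nhds 0)

section

open scoped Topology

theorem tendsto_integral_abs_translate_sub {φ : ℝ → ℝ} (hφ : Integrable φ) :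
    Tendsto (fun s : ℝ => ∫ y, |φ (y - s) - φ y|) (𝓝 0) (𝓝 0) := by
  have hm : MemLp φ 1 volume := memLp_one_iff_integrable.2 hφ
  have : Fact ((1 : ENNReal) ≠ ⊤) := ⟨ENNReal.one_ne_top⟩
  have hc : Continuous fun s : ℝ => ‖(DomAddAct.mk (-s) +ᵥ hm.toLp φ) - hm.toLp φ‖ := by
    have h1 : Continuous fun s : ℝ => DomAddAct.mk (-s) := by
      exact DomAddAct.continuous_mk.comp continuous_neg
    have h2 : Continuous fun s : ℝ => (DomAddAct.mk (-s) +ᵥ hm.toLp φ) :=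
      h1.vadd continuous_const
    exact (h2.sub continuous_const).norm
  have h0 := hc.tendsto 0
  have heq : ∀ s : ℝ, ‖(DomAddAct.mk (-s) +ᵥ hm.toLp φ) - hm.toLp φ‖
      = ∫ y, |φ (y - s) - φ y| := by
    intro s
    rw [L1.norm_eq_integral_norm]
    refine integral_congr_ae ?_
    rw [DomAddAct.mk_vadd_toLp]
    filter_upwards [Lp.coeFn_sub (MemLp.toLp _ (hm.comp_measurePreserving <|
      measurePreserving_vadd (-s) (volume : Measure ℝ))) (hm.toLp φ),
      MemLp.coeFn_toLp (hm.comp_measurePreserving <|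
      measurePreserving_vadd (-s) (volume : Measure ℝ)), hm.coeFn_toLp] with y h1 h2 h3
    rw [Real.norm_eq_abs]
    erw [h1]
    simp only [Pi.sub_apply]
    erw [h2, h3]
    simp [Function.comp, sub_eq_neg_add]
  simp only [heq] at h0
  simpa using h0

theorem integrable_mul_indicator_comp_sub {φ : ℝ → ℝ} (hφ : Integrable φ) {D : Set ℝ}
    (hD : MeasurableSet D) (x : ℝ) :
    Integrable fun y => φ y * D.indicator (fun _ => (1 : ℝ)) (x - y) := by
  refine hφ.mul_bdd (c := 1) ?_ (Eventually.of_forall fun y => ?_)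
  · exact ((measurable_const.indicator hD).comp (measurable_const.sub measurable_id)
      ).aestronglyMeasurable
  · by_cases h : x - y ∈ D <;> simp [h]

/-- A set meeting `I` in proportion at most `1 / m`, and yet so evenly spread that every average
of it against `φ` is at least `1 / (2 * m)`. -/
theorem exists_measurableSet_equidistributed {φ : ℝ → ℝ} (hφ : Integrable φ)
    (h1 : ∫ y, φ y = 1) (m : ℕ) [NeZero m] {I : Set ℝ} (hI : MeasurableSet I) :
    ∃ D : Set ℝ, MeasurableSet D ∧ m * volume (D ∩ I) ≤ volume I ∧
      ∀ x, 1 / (2 * m : ℝ) ≤ convR φ (D.indicator fun _ => 1) x := by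
  have hmpos : (0 : ℝ) < m := Nat.cast_pos.2 (NeZero.pos m)
  obtain ⟨s, hs0, hs⟩ : ∃ s : ℝ, 0 < s ∧ ∀ j ∈ Finset.range m,
      ∫ y, |φ (y - j * s) - φ y| ≤ 1 / (2 * m : ℝ) := by
    have hev : ∀ᶠ s in 𝓝[>] (0 : ℝ), ∀ j ∈ Finset.range m,
        ∫ y, |φ (y - j * s) - φ y| ≤ 1 / (2 * m : ℝ) := by
      rw [Filter.eventually_all_finset]
      intro j _
      have ht : Tendsto (fun s : ℝ => j * s) (𝓝[>] 0) (𝓝 0) := by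
        have : Tendsto (fun s : ℝ => j * s) (𝓝 0) (𝓝 (j * 0)) := tendsto_id.const_mul _
        rw [mul_zero] at this
        exact this.mono_left nhdsWithin_le_nhds
      exact ((tendsto_integral_abs_translate_sub hφ).comp ht).eventually_le_const
        (by positivity)
    obtain ⟨s, hs, hs0⟩ := (hev.and self_mem_nhdsWithin).exists
    exact ⟨s, hs0, hs⟩
  set D : ZMod m → Set ℝ := fun i => {x | ((⌊x / s⌋ : ℤ) : ZMod m) = i} with hDdef
  have hD : ∀ i, MeasurableSet (D i) := fun i =>
    (Int.measurable_floor.comp (measurable_id.div_const s))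
      (MeasurableSet.of_discrete (s := {k : ℤ | (k : ZMod m) = i}))
  have hshift : ∀ i (j : ℕ) x, x + j * s ∈ D (i + j) ↔ x ∈ D i := by
    intro i j x
    have : (x + j * s) / s = x / s + j := by field_simp
    simp [hDdef, this]
  have hsum : ∀ x, ∑ i, (D i).indicator (fun _ => (1 : ℝ)) x = 1 := by
    intro x
    simp [hDdef, Set.indicator_apply]
  have hTsum : ∀ x, ∑ i, convR φ ((D i).indicator fun _ => 1) x = 1 := by
    intro x
    unfold convR
    rw [← integral_finsetSum _ fun i _ => integrable_mul_indicator_comp_sub hφ (hD i) x]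
    simp only [← Finset.mul_sum, hsum, mul_one, h1]
  have hcomp : ∀ i x (j : ℕ), j < m → convR φ ((D (i + j)).indicator fun _ => 1) x
      ≤ convR φ ((D i).indicator fun _ => 1) x + 1 / (2 * m : ℝ) := by
    intro i x j hj
    have hφj : Integrable fun y => φ (y - j * s) := hφ.comp_sub_right _
    have e1 : convR φ ((D (i + j)).indicator fun _ => 1) x
        = ∫ y, φ (y - j * s) * (D i).indicator (fun _ => 1) (x - y) := by
      unfold convR
      rw [← integral_sub_right_eq_self _ (j * s)]
      congr 1 with y
      congr 1
      have := hshift i j (x - y)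
      rw [show x - y + j * s = x - (y - j * s) by ring] at this
      simp only [Set.indicator_apply, this]
    rw [e1]
    have hle : ∫ y, φ (y - j * s) * (D i).indicator (fun _ => 1) (x - y) ≤
        ∫ y, (φ y * (D i).indicator (fun _ => 1) (x - y) + |φ (y - j * s) - φ y|) := by
      refine integral_mono (integrable_mul_indicator_comp_sub hφj (hD i) x)
        ((integrable_mul_indicator_comp_sub hφ (hD i) x).add (hφj.sub hφ).abs) fun y => ?_
      by_cases h : x - y ∈ D i
      · simp only [h, Set.indicator_of_mem, mul_one]
        linarith [le_abs_self (φ (y - j * s) - φ y)]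
      · simp [h]
    rw [integral_add (g := fun y => |φ (y - j * s) - φ y|)
      (integrable_mul_indicator_comp_sub hφ (hD i) x) (hφj.sub hφ).abs] at hle
    exact hle.trans (add_le_add le_rfl (hs j (Finset.mem_range.2 hj)))
  have hlow : ∀ i x, 1 / (2 * m : ℝ) ≤ convR φ ((D i).indicator fun _ => 1) x := by
    intro i x
    have h2 : ∑ k, convR φ ((D k).indicator fun _ => 1) x ≤
        ∑ _k : ZMod m, (convR φ ((D i).indicator fun _ => 1) x + 1 / (2 * m : ℝ)) := by
      refine Finset.sum_le_sum fun k _ => ?_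
      have := hcomp i x (k - i).val (ZMod.val_lt _)
      simpa using this
    rw [hTsum] at h2
    simp only [Finset.sum_const, Finset.card_univ, ZMod.card, nsmul_eq_mul] at h2
    have h3 : (m : ℝ) * (1 / (2 * m)) = 1 / 2 := by field_simp
    rw [mul_add, h3] at h2
    rw [div_le_iff₀ (by positivity)]
    linarith
  obtain ⟨i, hi⟩ : ∃ i, m * volume (D i ∩ I) ≤ volume I := by
    by_contra! hcon
    have hpart : ∑ i, volume (D i ∩ I) = volume I := by
      rw [← measure_biUnion_finset]
      · congr 1
        ext x
        simp [hDdef]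
      · intro a _ b _ hab
        refine Set.disjoint_left.2 fun x hxa hxb => hab ?_
        exact hxa.1.symm.trans hxb.1
      · exact fun i _ => (hD i).inter hI
    have := ENNReal.sum_lt_sum_of_nonempty (s := Finset.univ) Finset.univ_nonempty
      (fun i _ => hcon i)
    rw [← Finset.mul_sum, hpart] at this
    simp at this
  exact ⟨D i, hD i, hi, hlow i⟩

theorem convR_congr_ae (φ : ℝ → ℝ) {f g : ℝ → ℝ} (h : f =ᵐ[volume] g) (x : ℝ) :
    convR φ f x = convR φ g x := by
  refine integral_congr_ae ?_
  filter_upwards [(quasiMeasurePreserving_sub_left volume x).ae_eq_comp h] with y hy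
  simp only [Function.comp] at hy
  rw [hy]

theorem aestronglyMeasurable_mul_comp_sub {φ f : ℝ → ℝ} (hφ : AEStronglyMeasurable φ)
    (hf : AEStronglyMeasurable f) :
    AEStronglyMeasurable (fun z : ℝ × ℝ => φ z.2 * f (z.1 - z.2)) (volume.prod volume) :=
  hφ.convolution_integrand (ContinuousLinearMap.mul ℝ ℝ) hf

theorem aestronglyMeasurable_convR {φ f : ℝ → ℝ} (hφ : AEStronglyMeasurable φ)
    (hf : AEStronglyMeasurable f) : AEStronglyMeasurable (convR φ f) :=
  (aestronglyMeasurable_mul_comp_sub hφ hf).integral_prod_right'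

theorem setLIntegral_enorm_comp_sub_le {p : ENNReal} (hp : 1 ≤ p) {f : ℝ → ℝ}
    (hf : AEStronglyMeasurable f) (I : Set ℝ) (y : ℝ) :
    ∫⁻ x in I, ‖f (x - y)‖ₑ ≤ eLpNorm f p volume * volume I ^ (1 - 1 / p.toReal) := by
  have hmp := measurePreserving_sub_right (volume : Measure ℝ) y
  have hfy : AEStronglyMeasurable (fun x => f (x - y)) := hf.comp_measurePreserving hmp
  have h := eLpNorm_le_eLpNorm_mul_rpow_measure_univ (μ := volume.restrict I) hp hfy.restrict
  rw [eLpNorm_one_eq_lintegral_enorm] at h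
  simp only [Measure.restrict_apply_univ, ENNReal.toReal_one, div_one] at h
  refine h.trans (mul_le_mul_left ?_ _)
  refine (eLpNorm_mono_measure _ Measure.restrict_le_self).trans_eq ?_
  exact eLpNorm_comp_measurePreserving hf hmp

theorem setLIntegral_lintegral_enorm_mul_comp_sub_le {p : ENNReal} (hp : 1 ≤ p) {φ f : ℝ → ℝ}
    (hφ : AEStronglyMeasurable φ) (hf : AEStronglyMeasurable f) (I : Set ℝ) :
    ∫⁻ x in I, ∫⁻ y, ‖φ y * f (x - y)‖ₑ ≤
      (∫⁻ y, ‖φ y‖ₑ) * (eLpNorm f p volume * volume I ^ (1 - 1 / p.toReal)) := by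
  have hm : AEMeasurable (Function.uncurry fun x y => ‖φ y * f (x - y)‖ₑ)
      ((volume.restrict I).prod volume) :=
    ((aestronglyMeasurable_mul_comp_sub hφ hf).enorm).mono_measure
      (Measure.prod_mono Measure.restrict_le_self le_rfl)
  rw [lintegral_lintegral_swap hm]
  have hφm : AEMeasurable (fun y => ‖φ y‖ₑ) := hφ.enorm
  rw [← lintegral_mul_const'' _ hφm]
  refine lintegral_mono fun y => ?_
  simp only [enorm_mul]
  rw [lintegral_const_mul' _ _ enorm_ne_top]
  exact mul_le_mul_right (setLIntegral_enorm_comp_sub_le hp hf I y) _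

theorem rpow_one_sub_inv_ne_top {p : ENNReal} (hp : 1 ≤ p) (hp2 : p ≠ ⊤) {v : ENNReal}
    (hv : v ≠ ⊤) : v ^ (1 - 1 / p.toReal) ≠ ⊤ := by
  refine ENNReal.rpow_ne_top_of_nonneg ?_ hv
  have : 1 ≤ p.toReal := by simpa using ENNReal.toReal_mono hp2 hp
  rw [sub_nonneg, div_le_one (by linarith)]
  exact this

theorem ae_integrable_mul_comp_sub {p : ENNReal} (hp : 1 ≤ p) (hp2 : p ≠ ⊤) {φ f : ℝ → ℝ}
    (hφ : Integrable φ) (hf : MemLp f p) :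
    ∀ᵐ x : ℝ, Integrable fun y => φ y * f (x - y) := by
  have key : ∀ k : ℕ, ∀ᵐ x ∂(volume.restrict (Set.Icc (-k : ℝ) k)),
      ∫⁻ y, ‖φ y * f (x - y)‖ₑ < ⊤ := by
    intro k
    refine ae_lt_top' ?_ (ne_top_of_le_ne_top ?_
      (setLIntegral_lintegral_enorm_mul_comp_sub_le hp hφ.1 hf.1 (Set.Icc (-k : ℝ) k)))
    · exact (((aestronglyMeasurable_mul_comp_sub hφ.1 hf.1).enorm).lintegral_prod_right'
        ).restrict
    · exact ENNReal.mul_ne_top hφ.2.ne (ENNReal.mul_ne_top hf.2.ne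
        (rpow_one_sub_inv_ne_top hp hp2 (by simp)))
  have hae : ∀ᵐ x : ℝ, ∀ k : ℕ, x ∈ Set.Icc (-k : ℝ) k → ∫⁻ y, ‖φ y * f (x - y)‖ₑ < ⊤ :=
    ae_all_iff.2 fun k => (ae_restrict_iff' measurableSet_Icc).1 (key k)
  filter_upwards [hae] with x hx
  obtain ⟨k, hk⟩ := exists_nat_ge |x|
  refine ⟨?_, hx k (abs_le.1 hk)⟩
  exact hφ.1.mul (hf.1.comp_quasiMeasurePreserving (quasiMeasurePreserving_sub_left volume x))

theorem convR_sub_ae {p : ENNReal} (hp : 1 ≤ p) (hp2 : p ≠ ⊤) {φ f g : ℝ → ℝ}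
    (hφ : Integrable φ) (hf : MemLp f p) (hg : MemLp g p) :
    ∀ᵐ x, convR φ (f - g) x = convR φ f x - convR φ g x := by
  filter_upwards [ae_integrable_mul_comp_sub hp hp2 hφ hf,
    ae_integrable_mul_comp_sub hp hp2 hφ hg] with x h1 h2
  unfold convR
  rw [← integral_sub h1 h2]
  simp only [Pi.sub_apply, mul_sub]

theorem convR_add_ae {p : ENNReal} (hp : 1 ≤ p) (hp2 : p ≠ ⊤) {φ f g : ℝ → ℝ}
    (hφ : Integrable φ) (hf : MemLp f p) (hg : MemLp g p) :
    ∀ᵐ x, convR φ (f + g) x = convR φ f x + convR φ g x := by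
  filter_upwards [ae_integrable_mul_comp_sub hp hp2 hφ hf,
    ae_integrable_mul_comp_sub hp hp2 hφ hg] with x h1 h2
  unfold convR
  rw [← integral_add h1 h2]
  simp only [Pi.add_apply, mul_add]

/-- The normalised error `(φ ⋆ f - f) / e` of approximating `f` by `φ ⋆ f`. -/
noncomputable def convError (φ : ℝ → ℝ) (e : ℝ) (f : ℝ → ℝ) (x : ℝ) : ℝ :=
  (convR φ f x - f x) / e

theorem aestronglyMeasurable_convError {φ f : ℝ → ℝ} (hφ : AEStronglyMeasurable φ) (e : ℝ)
    (hf : AEStronglyMeasurable f) : AEStronglyMeasurable (convError φ e f) := by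
  unfold convError
  simp only [div_eq_mul_inv]
  exact ((aestronglyMeasurable_convR hφ hf).sub hf).mul_const _

theorem convError_congr_ae (φ : ℝ → ℝ) (e : ℝ) {f g : ℝ → ℝ} (h : f =ᵐ[volume] g) :
    convError φ e f =ᵐ[volume] convError φ e g := by
  filter_upwards [h] with x hx
  simp only [convError, convR_congr_ae φ h, hx]

theorem convError_add_ae {p : ENNReal} (hp : 1 ≤ p) (hp2 : p ≠ ⊤) {φ f g : ℝ → ℝ}
    (hφ : Integrable φ) (e : ℝ) (hf : MemLp f p) (hg : MemLp g p) :
    ∀ᵐ x, convError φ e (f + g) x = convError φ e f x + convError φ e g x := by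
  filter_upwards [convR_add_ae hp hp2 hφ hf hg] with x hx
  simp only [convError, hx, Pi.add_apply]
  ring

theorem convError_sub_ae {p : ENNReal} (hp : 1 ≤ p) (hp2 : p ≠ ⊤) {φ f g : ℝ → ℝ}
    (hφ : Integrable φ) (e : ℝ) (hf : MemLp f p) (hg : MemLp g p) :
    ∀ᵐ x, convError φ e (f - g) x = convError φ e f x - convError φ e g x := by
  filter_upwards [convR_sub_ae hp hp2 hφ hf hg] with x hx
  simp only [convError, hx, Pi.sub_apply]
  ring

theorem convError_neg (φ : ℝ → ℝ) (e : ℝ) (f : ℝ → ℝ) (x : ℝ) :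
    convError φ e (-f) x = -convError φ e f x := by
  simp only [convError, convR, Pi.neg_apply, mul_neg, integral_neg]
  ring

theorem setLIntegral_enorm_convError_le {p : ENNReal} (hp : 1 ≤ p) {φ f : ℝ → ℝ}
    (hφ : AEStronglyMeasurable φ) (e : ℝ) (hf : AEStronglyMeasurable f) (I : Set ℝ) :
    ∫⁻ x in I, ‖convError φ e f x‖ₑ ≤
      ‖e⁻¹‖ₑ * (((∫⁻ y, ‖φ y‖ₑ) + 1) * volume I ^ (1 - 1 / p.toReal)) * eLpNorm f p volume := by
  have hle : ∀ x, ‖convError φ e f x‖ₑ ≤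
      ‖e⁻¹‖ₑ * ((∫⁻ y, ‖φ y * f (x - y)‖ₑ) + ‖f (x - 0)‖ₑ) := by
    intro x
    rw [convError, div_eq_inv_mul, enorm_mul, sub_zero]
    gcongr
    exact enorm_sub_le.trans (add_le_add (enorm_integral_le_lintegral_enorm _) le_rfl)
  refine (lintegral_mono hle).trans ?_
  rw [lintegral_const_mul' _ _ enorm_ne_top]
  have hm : AEMeasurable (fun x => ‖f (x - 0)‖ₑ) (volume.restrict I) := by
    simpa using hf.enorm.restrict
  rw [lintegral_add_right' _ hm]
  calc _ ≤ ‖e⁻¹‖ₑ * ((∫⁻ y, ‖φ y‖ₑ) * (eLpNorm f p volume * volume I ^ (1 - 1 / p.toReal)) +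
        eLpNorm f p volume * volume I ^ (1 - 1 / p.toReal)) := by
        gcongr
        · exact setLIntegral_lintegral_enorm_mul_comp_sub_le hp hφ hf I
        · exact setLIntegral_enorm_comp_sub_le hp hf I 0
    _ = _ := by ring

/-- A continuous substitute for the measure of the points of `I` where the normalised error of
`f` is at most `c`. -/
noncomputable def convDefect (φ : ℝ → ℝ) (e c : ℝ) (I : Set ℝ) (f : ℝ → ℝ) : ENNReal :=
  ∫⁻ x in I, ENNReal.ofReal (min 1 (c + 1 - convError φ e f x))

theorem convDefect_congr_ae (φ : ℝ → ℝ) (e c : ℝ) (I : Set ℝ) {f g : ℝ → ℝ}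
    (h : f =ᵐ[volume] g) : convDefect φ e c I f = convDefect φ e c I g := by
  refine lintegral_congr_ae (ae_restrict_of_ae ?_)
  filter_upwards [convError_congr_ae φ e h] with x hx
  rw [hx]

theorem continuous_convDefect (p : ENNReal) [Fact (1 ≤ p)] (hp2 : p ≠ ⊤) {φ : ℝ → ℝ}
    (hφ : Integrable φ) (e c : ℝ) {I : Set ℝ} (hI : volume I ≠ ⊤) :
    Continuous fun f : Lp ℝ p (volume : Measure ℝ) => convDefect φ e c I f := by
  have hp : 1 ≤ p := Fact.out
  refine continuous_of_le_add_edist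
    (‖e⁻¹‖ₑ * (((∫⁻ y, ‖φ y‖ₑ) + 1) * volume I ^ (1 - 1 / p.toReal))) ?_ fun f g => ?_
  · exact ENNReal.mul_ne_top enorm_ne_top (ENNReal.mul_ne_top
      (ENNReal.add_ne_top.2 ⟨hφ.2.ne, ENNReal.one_ne_top⟩) (rpow_one_sub_inv_ne_top hp hp2 hI))
  · have hf := Lp.memLp f
    have hg := Lp.memLp g
    rw [Lp.edist_def]
    refine le_trans ?_ (add_le_add le_rfl
      (setLIntegral_enorm_convError_le hp hφ.1 e (hf.sub hg).1 I))
    rw [convDefect, convDefect, ← lintegral_add_right' _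
      (aestronglyMeasurable_convError hφ.1 e (hf.sub hg).1).enorm.restrict]
    refine lintegral_mono_ae (ae_restrict_of_ae ?_)
    filter_upwards [convError_sub_ae hp hp2 hφ e hf hg] with x hx
    rw [hx, Real.enorm_eq_ofReal_abs]
    refine (ENNReal.ofReal_le_ofReal ?_).trans ENNReal.ofReal_add_le
    have h1 := neg_abs_le (convError φ e f x - convError φ e g x)
    have h2 := abs_nonneg (convError φ e f x - convError φ e g x)
    rcases min_cases 1 (c + 1 - convError φ e f x) with h | h <;>
    rcases min_cases 1 (c + 1 - convError φ e g x) with h' | h' <;> linarith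

theorem measure_convError_le_le_convDefect {φ f : ℝ → ℝ} (hφ : AEStronglyMeasurable φ) (e c : ℝ)
    (hf : AEStronglyMeasurable f) (I : Set ℝ) :
    volume.restrict I {x | convError φ e f x ≤ c} ≤ convDefect φ e c I f := by
  have hm : AEMeasurable (fun x => ENNReal.ofReal (min 1 (c + 1 - convError φ e f x)))
      (volume.restrict I) :=
    (aemeasurable_const.min (aemeasurable_const.sub
      (aestronglyMeasurable_convError hφ e hf).aemeasurable.restrict)).ennreal_ofReal
  refine le_trans ?_ ((one_mul _).symm.le.trans (mul_meas_ge_le_lintegral₀ hm 1))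
  refine measure_mono fun x (hx : _ ≤ c) => ?_
  simp only [Set.mem_ofPred_eq, ENNReal.one_le_ofReal, le_min_iff, le_refl, true_and]
  linarith

theorem convDefect_le_measure (φ f : ℝ → ℝ) (e c : ℝ) {I : Set ℝ} {B : Set ℝ}
    (hB : ∀ᵐ x ∂volume.restrict I, x ∉ B → c + 1 ≤ convError φ e f x) :
    convDefect φ e c I f ≤ volume.restrict I B := by
  refine le_trans (lintegral_mono_ae ?_) (lintegral_indicator_one_le B)
  filter_upwards [hB] with x hx
  by_cases h : x ∈ B
  · simp [h]
  · simp [h, hx h]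

theorem exists_pos_eLpNorm_indicator_const_le {p : ENNReal} (hp : 1 ≤ p) (hp2 : p ≠ ⊤)
    {K : Set ℝ} (hK : MeasurableSet K) (hKfin : volume K ≠ ⊤) {r : ENNReal} (hr : r ≠ 0) :
    ∃ a : ℝ, 0 < a ∧ eLpNorm (K.indicator fun _ => a) p volume ≤ r := by
  have hC : volume K ^ (1 / p.toReal) ≠ ⊤ := ENNReal.rpow_ne_top_of_nonneg (by positivity) hKfin
  obtain ⟨a, ha, hle⟩ := ENNReal.exists_nnreal_pos_mul_lt hC hr
  refine ⟨a, ha, ?_⟩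
  rw [eLpNorm_indicator_const hK (zero_lt_one.trans_le hp).ne' hp2]
  simpa using hle.le

theorem MeasureTheory.MemLp.exists_ae_locallyConstant_eLpNorm_sub_le {p : ENNReal} (hp : 1 ≤ p)
    (hp2 : p ≠ ⊤) {f : ℝ → ℝ} (hf : MemLp f p) {r : ENNReal} (hr : r ≠ 0) :
    ∃ g : ℝ → ℝ, MemLp g p ∧ eLpNorm (f - g) p volume ≤ r ∧
      ∀ᵐ x, ∀ᶠ y in 𝓝 x, g y = g x := by
  have hr2 : r / 2 ≠ 0 := (ENNReal.half_pos hr).ne'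
  obtain ⟨f₀, hsupp, hle, hcont, hf₀⟩ := hf.exists_hasCompactSupport_eLpNorm_sub_le hp2 hr2
  obtain ⟨A, hA⟩ : ∃ A : ℝ, ∀ x, A < |x| → f₀ x = 0 := by
    obtain ⟨A, hA⟩ := hsupp.isCompact.isBounded.subset_closedBall 0
    refine ⟨A, fun x hx => ?_⟩
    by_contra h
    have := hA (subset_tsupport f₀ h)
    rw [mem_closedBall_zero_iff, Real.norm_eq_abs] at this
    linarith
  obtain ⟨η, hη, hηle⟩ := exists_pos_eLpNorm_indicator_const_le hp hp2
    (measurableSet_Icc (a := -(A + 1)) (b := A + 1)) (by simp) hr2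
  obtain ⟨δ, hδ, huc⟩ := Metric.uniformContinuous_iff.1
    (hsupp.uniformContinuous_of_continuous hcont) η hη
  set τ := min δ 1
  have hτpos : 0 < τ := lt_min hδ one_pos
  set g : ℝ → ℝ := fun x => f₀ (τ * ⌊x / τ⌋) with hg
  have hgm : Measurable g := hcont.measurable.comp <| measurable_const.mul <|
    (measurable_from_top (f := fun k : ℤ => (k : ℝ))).comp <|
      Int.measurable_floor.comp (measurable_id.div_const τ)
  have hnear : ∀ x, |x - τ * ⌊x / τ⌋| < τ := by
    intro x
    have hx : x - τ * ⌊x / τ⌋ = τ * Int.fract (x / τ) := by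
      rw [Int.fract]; field_simp
    rw [hx, abs_of_nonneg (mul_nonneg hτpos.le (Int.fract_nonneg _))]
    exact mul_lt_of_lt_one_right hτpos (Int.fract_lt_one _)
  have hbound : ∀ x, ‖(f₀ - g) x‖ ≤ ‖(Set.Icc (-(A + 1)) (A + 1)).indicator (fun _ => η) x‖ := by
    intro x
    have hx := hnear x
    by_cases h : x ∈ Set.Icc (-(A + 1)) (A + 1)
    · rw [Set.indicator_of_mem h, Pi.sub_apply, ← dist_eq_norm, Real.norm_of_nonneg hη.le]
      exact (huc (by rw [Real.dist_eq]; exact hx.trans_le (min_le_left _ _))).le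
    · have hx' : A + 1 < |x| := by
        by_contra! hcon
        exact h (abs_le.1 hcon)
      have h1 : f₀ x = 0 := hA x (by linarith)
      have h2 : g x = 0 := by
        refine hA _ ?_
        have h3 := abs_sub_abs_le_abs_sub x (τ * ⌊x / τ⌋)
        have h4 : τ ≤ 1 := min_le_right _ _
        linarith
      simp [h1, h2]
  have hdiff : eLpNorm (f₀ - g) p volume ≤ r / 2 := (eLpNorm_mono hbound).trans hηle
  have hdiffLp : MemLp (f₀ - g) p :=
    (memLp_indicator_const p (measurableSet_Icc (a := -(A + 1)) (b := A + 1)) η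
      (Or.inr (by simp))).mono (hcont.measurable.sub hgm).aestronglyMeasurable
      (Eventually.of_forall hbound)
  refine ⟨g, ?_, ?_, ?_⟩
  · simpa using hf₀.sub hdiffLp
  · calc eLpNorm (f - g) p volume = eLpNorm ((f - f₀) + (f₀ - g)) p volume := by
          rw [sub_add_sub_cancel]
      _ ≤ eLpNorm (f - f₀) p volume + eLpNorm (f₀ - g) p volume :=
          eLpNorm_add_le (hf.sub hf₀).1 hdiffLp.1 hp
      _ ≤ r / 2 + r / 2 := add_le_add hle hdiff
      _ = r := ENNReal.add_halves r
  · have hnull : volume (Set.range fun k : ℤ => (k : ℝ) * τ) = 0 :=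
      (Set.countable_range _).measure_zero _
    filter_upwards [measure_eq_zero_iff_ae_notMem.1 hnull] with x hx
    have h1 : (⌊x / τ⌋ : ℝ) < x / τ := by
      refine lt_of_le_of_ne (Int.floor_le _) fun h => hx ⟨⌊x / τ⌋, ?_⟩
      simp only [h]
      field_simp
    have hc : Tendsto (fun y : ℝ => y / τ) (𝓝 x) (𝓝 (x / τ)) :=
      (continuous_id.div_const τ).tendsto x
    filter_upwards [hc.eventually_const_lt h1,
      hc.eventually_lt_const (Int.lt_floor_add_one (x / τ))] with y hy1 hy2
    simp only [hg]
    rw [Int.floor_eq_iff.2 ⟨hy1.le, hy2⟩]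

theorem IsProperApproxIdentity.integral_eq_one {φ : ℕ → ℝ → ℝ} (hφ : IsProperApproxIdentity φ)
    (n : ℕ) : ∫ y, φ n y = 1 := by
  rw [← hφ.norm_one n]
  exact integral_congr_ae (Eventually.of_forall fun y => (abs_of_nonneg (hφ.nonneg n y)).symm)

theorem IsProperApproxIdentity.eventually_convR_eq {φ : ℕ → ℝ → ℝ}
    (hφ : IsProperApproxIdentity φ) {g : ℝ → ℝ} {x : ℝ} (hg : ∀ᶠ y in 𝓝 x, g y = g x) :
    ∀ᶠ n in atTop, convR (φ n) g x = g x := by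
  obtain ⟨δ, hδ, h⟩ := Metric.eventually_nhds_iff.1 hg
  obtain ⟨N, hN⟩ := hφ.eventuallyLocal (δ / 2) (by positivity)
  filter_upwards [eventually_ge_atTop N] with n hn
  calc convR (φ n) g x = ∫ y, φ n y * g x := by
        refine integral_congr_ae ?_
        filter_upwards [hN n hn] with y hy
        by_cases hmem : y ∈ Set.Icc (-(δ / 2)) (δ / 2)
        · rw [h]
          rw [Real.dist_eq, sub_sub_cancel_left, abs_neg]
          exact (abs_le.2 hmem).trans_lt (by linarith)
        · simp [hy hmem]
    _ = g x := by rw [integral_mul_const, hφ.integral_eq_one, one_mul]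

theorem IsProperApproxIdentity.exists_convDefect_lt {p : ENNReal} (hp : 1 ≤ p) (hp2 : p ≠ ⊤)
    {φ : ℕ → ℝ → ℝ} (hφ : IsProperApproxIdentity φ) {ε : ℕ → ℝ} (hεpos : ∀ n, 0 < ε n)
    (hεlim : Tendsto ε atTop (𝓝 0)) {f : ℝ → ℝ} (hf : MemLp f p) {r δ : ENNReal} (hr : r ≠ 0)
    (hδ : δ ≠ 0) (c A : ℝ) (N : ℕ) :
    ∃ g : ℝ → ℝ, MemLp g p ∧ eLpNorm (f - g) p volume ≤ r ∧
      ∃ n ≥ N, convDefect (φ n) (ε n) c (Set.Icc (-A) A) g < δ := by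
  have hr2 : r / 2 ≠ 0 := (ENNReal.half_pos hr).ne'
  have hδ2 : δ / 2 ≠ 0 := (ENNReal.half_pos hδ).ne'
  set I := Set.Icc (-A) A with hI
  set J := Set.Icc (-(A + 1)) (A + 1)
  have hIfin : volume I ≠ ⊤ := by simp [hI]
  obtain ⟨g₀, hg₀, hle, hloc⟩ := hf.exists_ae_locallyConstant_eLpNorm_sub_le hp hp2 hr2
  obtain ⟨a, ha, hale⟩ := exists_pos_eLpNorm_indicator_const_le hp hp2
    (measurableSet_Icc (a := -(A + 1)) (b := A + 1)) (by simp) hr2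
  obtain ⟨m, hm⟩ := ENNReal.exists_nat_mul_gt hδ2 hIfin
  have : NeZero m := ⟨by rintro rfl; simp at hm⟩
  have hmpos : (0 : ℝ) < m := Nat.cast_pos.2 (NeZero.pos m)
  have hev1 : ∀ᶠ n in atTop, ε n * (c + 2) < a * (1 / (2 * m)) := by
    have : Tendsto (fun n => ε n * (c + 2)) atTop (𝓝 0) := by simpa using hεlim.mul_const (c + 2)
    exact this.eventually_lt_const (by positivity)
  have hev2 : ∀ᶠ n in atTop,
      volume.restrict I {x | 1 ≤ ‖convError (φ n) (ε n) g₀ x - 0‖} < δ / 2 := by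
    have : IsFiniteMeasure (volume.restrict I) := ⟨by simpa using hIfin.lt_top⟩
    have ht : TendstoInMeasure (volume.restrict I) (fun n => convError (φ n) (ε n) g₀) atTop
        (fun _ => (0 : ℝ)) := by
      refine tendstoInMeasure_of_tendsto_ae (fun n =>
        (aestronglyMeasurable_convError (hφ.integrable n).1 _ hg₀.1).restrict)
        (ae_restrict_of_ae ?_)
      filter_upwards [hloc] with x hx
      refine tendsto_const_nhds.congr' ?_
      filter_upwards [hφ.eventually_convR_eq hx] with n hn
      simp [convError, hn]
    exact (tendstoInMeasure_iff_norm.1 ht 1 one_pos).eventually_lt_const (pos_iff_ne_zero.2 hδ2)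
  obtain ⟨N₁, hN₁⟩ := hφ.eventuallyLocal 1 one_pos
  obtain ⟨n, hn1, hn2, hnN, hnN₁⟩ := (hev1.and (hev2.and ((eventually_ge_atTop N).and
    (eventually_ge_atTop N₁)))).exists
  obtain ⟨D, hD, hDI, hDconv⟩ := exists_measurableSet_equidistributed (hφ.integrable n)
    (hφ.integral_eq_one n) m (I := I) measurableSet_Icc
  have hDI' : volume (D ∩ I) < δ / 2 := lt_of_mul_lt_mul_left' (hDI.trans_lt hm)
  set h : ℝ → ℝ := (D ∩ J).indicator fun _ => a with hh
  have hhLp : MemLp h p := memLp_indicator_const p (hD.inter measurableSet_Icc) a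
    (Or.inr (measure_ne_top_of_subset Set.inter_subset_right (by simp)))
  have hhle : eLpNorm h p volume ≤ r / 2 := by
    refine le_trans (eLpNorm_mono fun x => ?_) hale
    exact norm_indicator_le_of_subset Set.inter_subset_right _ _
  have hconv : ∀ x ∈ I, a * (1 / (2 * m)) ≤ convR (φ n) h x := by
    intro x hx
    refine (mul_le_mul_of_nonneg_left (hDconv x) ha.le).trans_eq ?_
    unfold convR
    rw [← integral_const_mul]
    refine integral_congr_ae ?_
    filter_upwards [hN₁ n hnN₁] with y hy
    by_cases hmem : y ∈ Set.Icc (-1 : ℝ) 1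
    · have hxy : x - y ∈ J := ⟨by linarith [hx.1, hmem.2], by linarith [hx.2, hmem.1]⟩
      by_cases hxD : x - y ∈ D
      · simp [hh, hxy, hxD, mul_comm]
      · simp [hh, hxD]
    · simp [hy hmem]
  refine ⟨g₀ + h, hg₀.add hhLp, ?_, n, hnN, ?_⟩
  · calc eLpNorm (f - (g₀ + h)) p volume = eLpNorm ((f - g₀) - h) p volume := by
          rw [sub_add_eq_sub_sub]
      _ ≤ eLpNorm (f - g₀) p volume + eLpNorm h p volume :=
          eLpNorm_sub_le (hf.sub hg₀).1 hhLp.1 hp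
      _ ≤ r / 2 + r / 2 := add_le_add hle hhle
      _ = r := ENNReal.add_halves r
  · have hB := convDefect_le_measure (φ n) (g₀ + h) (ε n) c (I := I)
      (B := {x | 1 ≤ ‖convError (φ n) (ε n) g₀ x - 0‖} ∪ D) ?_
    · refine hB.trans_lt ((measure_union_le _ _).trans_lt ?_)
      rw [Measure.restrict_apply hD]
      exact (ENNReal.add_lt_add hn2 hDI').trans_eq (ENNReal.add_halves δ)
    · filter_upwards [ae_restrict_mem measurableSet_Icc, ae_restrict_of_ae
        (convError_add_ae hp hp2 (hφ.integrable n) (ε n) hg₀ hhLp)] with x hxI hx hxB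
      simp only [sub_zero, Real.norm_eq_abs, Set.mem_union, Set.mem_ofPred_eq, not_or,
        not_le] at hxB
      have hhx : h x = 0 := Set.indicator_of_notMem (fun hmem => hxB.2 hmem.1) _
      have h1 : c + 2 ≤ convError (φ n) (ε n) h x := by
        rw [convError, hhx, sub_zero, le_div_iff₀ (hεpos n)]
        linarith [hconv x hxI]
      rw [hx]
      linarith [(abs_lt.1 hxB.1).1]

/-- Some normalised error of index at least `j` exceeds `j` on `[-j, j]`, up to a set of measure
about `2⁻¹ ^ j`. -/
def largeErrorSet (p : ENNReal) (φ : ℕ → ℝ → ℝ) (ε : ℕ → ℝ) (j : ℕ) :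
    Set (Lp ℝ p (volume : Measure ℝ)) :=
  {f | ∃ n ≥ j, convDefect (φ n) (ε n) j (Set.Icc (-j) j) f < 2⁻¹ ^ j}

theorem isOpen_largeErrorSet (p : ENNReal) [Fact (1 ≤ p)] (hp2 : p ≠ ⊤) {φ : ℕ → ℝ → ℝ}
    (hφ : IsProperApproxIdentity φ) (ε : ℕ → ℝ) (j : ℕ) : IsOpen (largeErrorSet p φ ε j) := by
  have : largeErrorSet p φ ε j = ⋃ n, ⋃ (_ : n ≥ j),
      {f : Lp ℝ p (volume : Measure ℝ) |
        convDefect (φ n) (ε n) j (Set.Icc (-j) j) f < 2⁻¹ ^ j} := by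
    ext f
    simp [largeErrorSet]
  rw [this]
  exact isOpen_iUnion fun n => isOpen_iUnion fun _ => isOpen_lt
    (continuous_convDefect p hp2 (hφ.integrable n) (ε n) j (by simp)) continuous_const

theorem dense_largeErrorSet (p : ENNReal) [Fact (1 ≤ p)] (hp2 : p ≠ ⊤) {φ : ℕ → ℝ → ℝ}
    (hφ : IsProperApproxIdentity φ) {ε : ℕ → ℝ} (hεpos : ∀ n, 0 < ε n)
    (hεlim : Tendsto ε atTop (𝓝 0)) (j : ℕ) : Dense (largeErrorSet p φ ε j) := by
  intro f
  rw [EMetric.mem_closure_iff]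
  intro r hr
  obtain ⟨g, hg, hle, n, hn, hlt⟩ := hφ.exists_convDefect_lt Fact.out hp2 hεpos hεlim
    (Lp.memLp f) (ENNReal.half_pos hr.ne').ne' (δ := 2⁻¹ ^ j) (by simp) j j j
  by_cases hrt : r = ⊤
  · refine ⟨hg.toLp g, ⟨n, hn, ?_⟩, hrt ▸ edist_lt_top _ _⟩
    rwa [convDefect_congr_ae _ _ _ _ hg.coeFn_toLp]
  · refine ⟨hg.toLp g, ⟨n, hn, ?_⟩, ?_⟩
    · rwa [convDefect_congr_ae _ _ _ _ hg.coeFn_toLp]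
    · rw [Lp.edist_def, eLpNorm_congr_ae ((EventuallyEq.refl _ _).sub hg.coeFn_toLp)]
      exact hle.trans_lt (ENNReal.half_lt_self hr.ne' hrt)

theorem limsup_convError_eq_top {p : ENNReal} {φ : ℕ → ℝ → ℝ} (hφ : IsProperApproxIdentity φ)
    {ε : ℕ → ℝ} {f : Lp ℝ p (volume : Measure ℝ)} (hf : ∀ j, f ∈ largeErrorSet p φ ε j) :
    ∀ᵐ x, limsup (fun n => (convError (φ n) (ε n) f x : EReal)) atTop = ⊤ := by
  choose n hn hlt using hf
  have hsum : ∑' j : ℕ, volume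
      ({x | convError (φ (n j)) (ε (n j)) f x ≤ j} ∩ Set.Icc (-j : ℝ) j) ≠ ⊤ := by
    refine ne_top_of_le_ne_top ?_ (ENNReal.tsum_le_tsum fun j => ?_) (b := ∑' j : ℕ, 2⁻¹ ^ j)
    · rw [ENNReal.tsum_geometric]
      simp
    · exact (Measure.le_restrict_apply _ _).trans ((measure_convError_le_le_convDefect
        (hφ.integrable _).1 _ _ (Lp.aestronglyMeasurable f) _).trans (hlt j).le)
  filter_upwards [ae_eventually_notMem hsum] with x hx
  rw [EReal.eq_top_iff_forall_lt]
  intro y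
  have hfreq : ∃ᶠ k in atTop, ((y + 1 : ℝ) : EReal) ≤ (convError (φ k) (ε k) f x : EReal) := by
    rw [frequently_atTop]
    intro N
    obtain ⟨M, hM⟩ := exists_nat_ge (max |x| (y + 1))
    obtain ⟨j, hj, hjN, hjM⟩ := (hx.and ((eventually_ge_atTop N).and
      (eventually_ge_atTop M))).exists
    have hMj : max |x| (y + 1) ≤ j := hM.trans (Nat.cast_le.2 hjM)
    refine ⟨n j, hjN.trans (hn j), EReal.coe_le_coe_iff.2 ?_⟩
    by_contra! hcon
    exact hj ⟨hcon.le.trans ((le_max_right _ _).trans hMj),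
      abs_le.1 ((le_max_left _ _).trans hMj)⟩
  refine lt_of_lt_of_le ?_ (le_limsup_of_frequently_le hfreq)
  exact EReal.coe_lt_coe_iff.2 (by linarith)

end

theorem stmt_6 (p : ENNReal) [Fact (1 ≤ p)] (hp2 : p ≠ ⊤)
    (φ : ℕ → ℝ → ℝ) (hφ : IsProperApproxIdentity φ)
    (ε : ℕ → ℝ) (hεpos : ∀ n, 0 < ε n) (hεlim : Tendsto ε atTop (nhds 0)) :
    ∃ 𝒜 : Set (Lp ℝ p (volume : Measure ℝ)), Dense 𝒜 ∧ IsGδ 𝒜 ∧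
      ∀ f ∈ 𝒜,
        (∀ᵐ x ∂(volume : Measure ℝ),
          Filter.limsup (fun n => (((convR (φ n) (⇑f) x - f x) / ε n : ℝ) : EReal)) atTop = ⊤) ∧
        (∀ᵐ x ∂(volume : Measure ℝ),
          Filter.liminf (fun n => (((convR (φ n) (⇑f) x - f x) / ε n : ℝ) : EReal)) atTop = ⊥) := by
  set S : Set (Lp ℝ p (volume : Measure ℝ)) := ⋂ j, largeErrorSet p φ ε j with hS
  have hSdense : Dense S := dense_iInter_of_isOpen_nat
    (isOpen_largeErrorSet p hp2 hφ ε) (dense_largeErrorSet p hp2 hφ hεpos hεlim)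
  have hSδ : IsGδ S := IsGδ.iInter_of_isOpen (isOpen_largeErrorSet p hp2 hφ ε)
  have hNδ : IsGδ (Neg.neg ⁻¹' S) := hSδ.preimage continuous_neg
  refine ⟨S ∩ Neg.neg ⁻¹' S, hSdense.inter_of_Gδ hSδ hNδ
    (hSdense.preimage (Homeomorph.neg _).isOpenMap), hSδ.inter hNδ, fun f hf => ⟨?_, ?_⟩⟩
  · exact limsup_convError_eq_top hφ (Set.mem_iInter.1 hf.1)
  · have hneg : ∀ᵐ x, ∀ n,
        convError (φ n) (ε n) ⇑(-f) x = -convError (φ n) (ε n) f x := by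
      refine ae_all_iff.2 fun n => ?_
      filter_upwards [convError_congr_ae (φ n) (ε n) (Lp.coeFn_neg f)] with x hx
      rw [hx, convError_neg]
    filter_upwards [limsup_convError_eq_top hφ (Set.mem_iInter.1 hf.2), hneg] with x hx hnx
    have hlim : limsup (-fun n => (convError (φ n) (ε n) f x : EReal)) atTop = ⊤ := by
      rw [← hx]
      congr 1 with n
      rw [hnx n, EReal.coe_neg, Pi.neg_apply]
    rw [EReal.limsup_neg, EReal.neg_eq_top_iff] at hlim
    exact hlim
end

section
/- Let (X, μ) be a probability space and T : X → X an ergodic measure-preserving transformation. Suppose there exist integers M > N ≥ 1 and a function f ∈ L¹(μ) that is not a.e. equal to a constant such that A_M f(x) = A_N f(x) for almost every x ∈ X. Then T is not totally ergodic, i.e. there exists an integer k ≥ 2 such that T^k is not ergodic. -/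
open MeasureTheory Filter

theorem sqrt_one_add_sq_convexComb {α β : ℝ} (hα : 0 < α) (hβ : 0 < β) (h : α + β = 1) (a b : ℝ) :
    √(1 + (α * a + β * b) ^ 2) ≤ α * √(1 + a ^ 2) + β * √(1 + b ^ 2) ∧
    (√(1 + (α * a + β * b) ^ 2) = α * √(1 + a ^ 2) + β * √(1 + b ^ 2) → a = b) := by
  have hp := Real.sq_sqrt (show 0 ≤ 1 + a ^ 2 by positivity)
  have hq := Real.sq_sqrt (show 0 ≤ 1 + b ^ 2 by positivity)
  have hr := Real.sq_sqrt (show 0 ≤ 1 + (α * a + β * b) ^ 2 by positivity)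
  have hp0 := Real.sqrt_nonneg (1 + a ^ 2)
  have hq0 := Real.sqrt_nonneg (1 + b ^ 2)
  set p := √(1 + a ^ 2)
  set q := √(1 + b ^ 2)
  obtain rfl : β = 1 - α := by linarith
  have hpq : (p * q) ^ 2 = (1 + a * b) ^ 2 + (a - b) ^ 2 := by
    rw [mul_pow, hp, hq]; ring
  have hle : 1 + a * b ≤ p * q :=
    le_of_sq_le_sq (by nlinarith [sq_nonneg (a - b)]) (by positivity)
  have key : (α * p + (1 - α) * q) ^ 2 =
      1 + (α * a + (1 - α) * b) ^ 2 + 2 * (α * (1 - α)) * (p * q - (1 + a * b)) := by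
    linear_combination α ^ 2 * hp + (1 - α) ^ 2 * hq
  have hαβ : 0 < α * (1 - α) := mul_pos hα hβ
  refine ⟨Real.sqrt_le_iff.2 ⟨by positivity, ?_⟩, fun he => ?_⟩
  · rw [key]
    nlinarith [mul_nonneg hαβ.le (sub_nonneg.2 hle)]
  · rw [← he, hr] at key
    have h0 : p * q - (1 + a * b) = 0 := by
      have : (α * (1 - α)) * (p * q - (1 + a * b)) = 0 := by linarith
      exact (mul_eq_zero.1 this).resolve_left hαβ.ne'
    have : (a - b) ^ 2 = 0 := by
      rw [sub_eq_zero.1 h0] at hpq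
      linarith
    exact sub_eq_zero.1 (pow_eq_zero_iff two_ne_zero |>.1 this)

theorem MeasureTheory.Integrable.sqrt_one_add_sq {X : Type*} [MeasurableSpace X] {μ : Measure X}
    [IsFiniteMeasure μ] {f : X → ℝ} (hf : Integrable f μ) :
    Integrable (fun x => √(1 + f x ^ 2)) μ := by
  refine ((integrable_const (1 : ℝ)).add hf.abs).mono' ?_ (ae_of_all _ fun x => ?_)
  · exact (by fun_prop : Continuous fun y : ℝ => √(1 + y ^ 2)).comp_aestronglyMeasurable hf.1
  · rw [Real.norm_of_nonneg (Real.sqrt_nonneg _)]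
    refine Real.sqrt_le_iff.2 ⟨by simp only [Pi.add_apply]; positivity, ?_⟩
    simp only [Pi.add_apply]
    nlinarith [abs_nonneg (f x), sq_abs (f x)]

theorem MeasureTheory.MeasurePreserving.integral_comp_of_aestronglyMeasurable
    {X Y : Type*} [MeasurableSpace X] [MeasurableSpace Y] {μ : Measure X} {ν : Measure Y}
    {T : X → Y} (hT : MeasurePreserving T μ ν) {g : Y → ℝ} (hg : AEStronglyMeasurable g ν) :
    ∫ x, g (T x) ∂μ = ∫ y, g y ∂ν := by
  rw [← hT.map_eq, integral_map hT.measurable.aemeasurable (by rwa [hT.map_eq])]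

/-- If `g ∘ R` is a proper convex combination of `g ∘ S` and `g` for measure-preserving maps
`R` and `S`, then `g` is `S`-invariant. -/
theorem MeasureTheory.MeasurePreserving.comp_ae_eq_of_convexComb {X : Type*} [MeasurableSpace X]
    {μ : Measure X} [IsFiniteMeasure μ] {R S : X → X} (hR : MeasurePreserving R μ μ)
    (hS : MeasurePreserving S μ μ) {g : X → ℝ} (hg : Integrable g μ) {α β : ℝ} (hα : 0 < α)
    (hβ : 0 < β) (hαβ : α + β = 1) (h : ∀ᵐ x ∂μ, g (R x) = α * g (S x) + β * g x) :
    g ∘ S =ᵐ[μ] g := by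
  set φ : X → ℝ := fun x => √(1 + g x ^ 2)
  have hφ : Integrable φ μ := hg.sqrt_one_add_sq
  have hφR : Integrable (fun x => φ (R x)) μ := hR.integrable_comp_of_integrable hφ
  have hφS : Integrable (fun x => φ (S x)) μ := hS.integrable_comp_of_integrable hφ
  have hle : (fun x => φ (R x)) ≤ᵐ[μ] fun x => α * φ (S x) + β * φ x := by
    filter_upwards [h] with x hx
    simp only [φ, hx]
    exact (sqrt_one_add_sq_convexComb hα hβ hαβ _ _).1
  have hint : ∫ x, φ (R x) ∂μ = ∫ x, (α * φ (S x) + β * φ x) ∂μ := by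
    rw [integral_add (hφS.const_mul α) (hφ.const_mul β), integral_const_mul, integral_const_mul,
      hR.integral_comp_of_aestronglyMeasurable hφ.1, hS.integral_comp_of_aestronglyMeasurable hφ.1,
      ← add_mul, hαβ, one_mul]
  have heq := (integral_eq_iff_of_ae_le hφR ((hφS.const_mul α).add (hφ.const_mul β)) hle).1 hint
  filter_upwards [h, heq] with x hx hx'
  refine (sqrt_one_add_sq_convexComb hα hβ hαβ (g (S x)) (g x)).2 ?_
  rw [← hx]
  exact hx'

theorem birkhoffAvg_apply_self {X : Type*} (T : X → X) (f : X → ℝ) (n : ℕ) (x : X) :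
    birkhoffAvg T f n (T x) =
      birkhoffAvg T f n x + (n : ℝ)⁻¹ * (f (T (T^[n] x)) - f (T x)) := by
  unfold birkhoffAvg
  rw [← mul_add]
  congr 1
  induction n with
  | zero => simp
  | succ n ih =>
    rw [Finset.sum_Icc_succ_top (by simp), Finset.sum_Icc_succ_top (by simp), ih,
      ← Function.iterate_succ_apply, ← Function.iterate_succ_apply' T n,
      ← Function.iterate_succ_apply' T (n + 1), Function.iterate_succ_apply T (n + 1)]
    ring

theorem stmt_8 {X : Type*} [MeasurableSpace X] (μ : Measure X) [IsProbabilityMeasure μ]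
    (T : X → X) (hT : Ergodic T μ)
    (M N : ℕ) (hN : 1 ≤ N) (hMN : N < M)
    (f : X → ℝ) (hf : Integrable f μ) (hnc : ¬ ∃ c : ℝ, f =ᵐ[μ] fun _ => c)
    (heq : ∀ᵐ x ∂μ, birkhoffAvg T f M x = birkhoffAvg T f N x) :
    ∃ k : ℕ, 2 ≤ k ∧ ¬ Ergodic (T^[k]) μ := by
  refine ⟨M, by omega, fun hM => hnc ?_⟩
  have hTm := hT.toMeasurePreserving
  have hN0 : (0 : ℝ) < N := by exact_mod_cast hN
  have hNM : (N : ℝ) < M := by exact_mod_cast hMN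
  have hM0 : (0 : ℝ) < M := hN0.trans hNM
  have hg : Integrable (f ∘ T) μ := hTm.integrable_comp_of_integrable hf
  have hinv : (f ∘ T) ∘ T^[M] =ᵐ[μ] f ∘ T := by
    refine (hTm.iterate N).comp_ae_eq_of_convexComb (hTm.iterate M) hg
      (α := N / M) (β := (M - N) / M) (by positivity) (div_pos (by linarith) hM0)
      (by field_simp; ring) ?_
    filter_upwards [heq, hTm.quasiMeasurePreserving.ae heq] with x hx hTx
    rw [birkhoffAvg_apply_self, birkhoffAvg_apply_self, hx, add_right_inj] at hTx
    simp only [Function.comp_apply]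
    field_simp at hTx ⊢
    linarith
  obtain ⟨c, hc⟩ := hM.ae_eq_const_of_ae_eq_comp_ae hg.1 hinv
  have hfc : Integrable (fun x => |f x - c|) μ := (hf.sub (integrable_const c)).abs
  have h0 : ∫ x, |f x - c| ∂μ = 0 := by
    rw [← hTm.integral_comp_of_aestronglyMeasurable hfc.1]
    refine integral_eq_zero_of_ae ?_
    filter_upwards [hc] with x hx
    simpa [sub_eq_zero] using hx
  refine ⟨c, ?_⟩
  filter_upwards [(integral_eq_zero_iff_of_nonneg (fun x => abs_nonneg _) hfc).1 h0] with x hx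
  simpa [sub_eq_zero] using hx
end

section
/- Let (X, μ, T) be an ergodic measure-preserving system on a probability space and suppose the sequence (N_i)_{i≥1} of positive integers satisfies the complete recurrence property for (X, μ, T). Let F : X → ℝ be measurable with no upper barrier and no lower barrier, and suppose f = F − F∘T is integrable with ∫ f dμ = 0. Then for almost every x ∈ X, A_{N_i} f(x) < 0 for infinitely many i and A_{N_i} f(x) > 0 for infinitely many i. -/
open MeasureTheory Filter

/-- `F` has an upper barrier: a set of positive measure on which `F` is constant `p`,
with `F ≤ p` a.e. -/
def HasUpperBarrier {X : Type*} [MeasurableSpace X] (μ : Measure X) (F : X → ℝ) : Prop :=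
  ∃ P : Set X, MeasurableSet P ∧ 0 < μ P ∧
    ∃ p : ℝ, (∀ x ∈ P, F x = p) ∧ ∀ᵐ y ∂μ, F y ≤ p

/-- `F` has a lower barrier: a set of positive measure on which `F` is constant `q`,
with `F ≥ q` a.e. -/
def HasLowerBarrier {X : Type*} [MeasurableSpace X] (μ : Measure X) (F : X → ℝ) : Prop :=
  ∃ Q : Set X, MeasurableSet Q ∧ 0 < μ Q ∧
    ∃ q : ℝ, (∀ x ∈ Q, F x = q) ∧ ∀ᵐ y ∂μ, q ≤ F y

/-- If `F` has no upper barrier, then almost no point is an almost sure maximum of `F`. -/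
lemma ae_measure_lt_pos_of_not_hasUpperBarrier {X : Type*} [MeasurableSpace X] {μ : Measure X}
    {F : X → ℝ} (hF : Measurable F) (hno : ¬ HasUpperBarrier μ F) :
    ∀ᵐ y ∂μ, 0 < μ {z | F y < F z} := by
  have hnull : ∀ᵐ y ∂μ, ∀ q : ℚ, μ {z | (q : ℝ) < F z} = 0 → F y ≤ q := by
    rw [ae_all_iff]
    intro q
    by_cases h : μ {z | (q : ℝ) < F z} = 0
    · simp [h, ae_iff]
    · simp [h]
  by_contra hbad
  obtain ⟨y, hy, hy'⟩ := ((not_eventually.mp hbad).and_eventually hnull).exists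
  rw [not_lt, nonpos_iff_eq_zero] at hy
  have hle : ∀ᵐ z ∂μ, F z ≤ F y := by simpa [ae_iff] using hy
  have hset : MeasurableSet {z | F z = F y} := hF (measurableSet_singleton (F y))
  refine hno ⟨{z | F z = F y}, hset, pos_iff_ne_zero.mpr fun h0 ↦ hbad ?_,
    F y, fun z hz ↦ hz, hle⟩
  have hne : ∀ᵐ z ∂μ, F z ≠ F y := by simpa [ae_iff] using h0
  filter_upwards [hle, hne] with z hz hz'
  obtain ⟨q, hzq, hqy⟩ := exists_rat_btwn (lt_of_le_of_ne hz hz')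
  have hq : μ {w | (q : ℝ) < F w} ≠ 0 := fun h ↦ (hy' q h).not_gt hqy
  exact (pos_iff_ne_zero.mpr hq).trans_le
    (measure_mono fun w (hw : (q : ℝ) < F w) ↦ hzq.trans hw)

/-- Under complete recurrence, a function without upper barrier is exceeded infinitely often
along almost every orbit. -/
lemma ae_frequently_lt_of_not_hasUpperBarrier {X : Type*} [MeasurableSpace X] {μ : Measure X}
    [IsProbabilityMeasure μ] {T : X → X} (hT : Measurable T) {N : ℕ → ℕ}
    (hrec : ∀ E : Set X, MeasurableSet E → 0 < μ E →
      ∀ L : ℕ, μ (⋃ i ∈ Set.Ici L, T^[N i] ⁻¹' E) = 1)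
    {F : X → ℝ} (hF : Measurable F) (hno : ¬ HasUpperBarrier μ F) :
    ∀ᵐ y ∂μ, ∃ᶠ i in atTop, F y < F (T^[N i] y) := by
  have hvisit : ∀ᵐ y ∂μ, ∀ q : ℚ, 0 < μ {z | (q : ℝ) < F z} →
      ∀ L : ℕ, ∃ i ≥ L, (q : ℝ) < F (T^[N i] y) := by
    simp_rw [ae_all_iff]
    intro q hq L
    have hE : MeasurableSet {z | (q : ℝ) < F z} := measurableSet_lt measurable_const hF
    have hU : MeasurableSet (⋃ i ∈ Set.Ici L, T^[N i] ⁻¹' {z | (q : ℝ) < F z}) :=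
      MeasurableSet.biUnion (Set.to_countable _) fun i _ ↦ (hT.iterate _) hE
    filter_upwards [(mem_ae_iff_prob_eq_one hU).mpr (hrec _ hE hq L)] with y hy
    simpa using hy
  filter_upwards [hvisit, ae_measure_lt_pos_of_not_hasUpperBarrier hF hno] with y hy hpos
  have hcover : {z | F y < F z} ⊆ ⋃ q : {q : ℚ // F y < q}, {z | (q : ℝ) < F z} := by
    intro z hz
    obtain ⟨q, hyq, hqz⟩ := exists_rat_btwn (show F y < F z from hz)
    exact Set.mem_iUnion.mpr ⟨⟨q, hyq⟩, hqz⟩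
  obtain ⟨⟨q, hyq⟩, hq⟩ :=
    exists_measure_pos_of_not_measure_iUnion_null (hpos.trans_le (measure_mono hcover)).ne'
  rw [frequently_atTop]
  intro L
  obtain ⟨i, hi, hlt⟩ := hy q hq L
  exact ⟨i, hi, hyq.trans hlt⟩

lemma HasUpperBarrier.hasLowerBarrier_of_neg {X : Type*} [MeasurableSpace X] {μ : Measure X}
    {F : X → ℝ} (h : HasUpperBarrier μ fun x ↦ -F x) : HasLowerBarrier μ F := by
  obtain ⟨P, hP, hpos, p, hp, hle⟩ := h
  refine ⟨P, hP, hpos, -p, fun x hx ↦ by linarith [hp x hx], ?_⟩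
  filter_upwards [hle] with y hy
  linarith

/-- The Birkhoff averages of a coboundary telescope. -/
lemma birkhoffAvg_coboundary {X : Type*} (T : X → X) (F : X → ℝ) (N : ℕ) (x : X) :
    birkhoffAvg T (fun x ↦ F x - F (T x)) N x = (N : ℝ)⁻¹ * (F (T x) - F (T^[N] (T x))) := by
  have hsum : ∑ n ∈ Finset.Icc 1 N, (F (T^[n] x) - F (T (T^[n] x))) =
      F (T x) - F (T^[N] (T x)) := by
    induction N with
    | zero => simp
    | succ k ih =>
      rw [Finset.sum_Icc_succ_top (by omega), ih, ← Function.iterate_succ_apply' T (k + 1) x,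
        Function.iterate_succ_apply T k x, Function.iterate_succ_apply T (k + 1) x]
      ring
  rw [birkhoffAvg, hsum]

theorem stmt_11 {X : Type*} [MeasurableSpace X] (μ : Measure X) [IsProbabilityMeasure μ]
    (T : X → X) (hT : Ergodic T μ)
    (N : ℕ → ℕ) (hpos : ∀ i, 1 ≤ N i)
    (hrec : ∀ E : Set X, MeasurableSet E → 0 < μ E →
      ∀ L : ℕ, μ (⋃ i ∈ Set.Ici L, T^[N i] ⁻¹' E) = 1)
    (F : X → ℝ) (hFmeas : Measurable F)
    (hnoUpper : ¬ HasUpperBarrier μ F) (hnoLower : ¬ HasLowerBarrier μ F)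
    (f : X → ℝ) (hfdef : f = fun x => F x - F (T x))
    (hfint : Integrable f μ) (hf0 : ∫ x, f x ∂μ = 0) :
    ∀ᵐ x ∂μ,
      (∃ᶠ i in atTop, birkhoffAvg T f (N i) x < 0) ∧
      (∃ᶠ i in atTop, birkhoffAvg T f (N i) x > 0) := by
  have hup := ae_frequently_lt_of_not_hasUpperBarrier hT.measurable hrec hFmeas hnoUpper
  have hlow := ae_frequently_lt_of_not_hasUpperBarrier hT.measurable hrec hFmeas.neg
    fun h ↦ hnoLower h.hasLowerBarrier_of_neg
  have hinv : ∀ i, 0 < (N i : ℝ)⁻¹ := fun i ↦ inv_pos.mpr (Nat.cast_pos.mpr (hpos i))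
  subst hfdef
  filter_upwards [hT.quasiMeasurePreserving.ae hup, hT.quasiMeasurePreserving.ae hlow]
    with x hx hx'
  simp only [birkhoffAvg_coboundary]
  exact ⟨hx.mono fun i hi ↦ mul_neg_of_pos_of_neg (hinv i) (sub_neg.mpr hi),
    hx'.mono fun i hi ↦ mul_pos (hinv i) (sub_pos.mpr (neg_lt_neg_iff.mp hi))⟩
end

section
/- Let (X, μ) be a probability space and T : X → X a totally ergodic measure-preserving transformation. Then for every measurable set E with 0 < μ(E) < 1, for almost every x ∈ X the averages A_N 𝟙_E(x) = (1/N) ∑_{n=1}^{N} 𝟙_E(Tⁿ x) satisfy A_N 𝟙_E(x) > μ(E) for infinitely many N and A_N 𝟙_E(x) < μ(E) for infinitely many N. -/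
open MeasureTheory Filter

section MaximalSums

variable {X : Type*}

/-- The maximum of the Birkhoff sums `birkhoffSum T g k x` over `k ≤ n`, defined recursively. -/
noncomputable def maximalSum (T : X → X) (g : X → ℝ) : ℕ → X → ℝ
  | 0, _ => 0
  | n + 1, x => max 0 (g x + maximalSum T g n (T x))

variable {T : X → X} {g : X → ℝ}

lemma maximalSum_nonneg (n : ℕ) (x : X) : 0 ≤ maximalSum T g n x := by
  cases n <;> simp [maximalSum]

lemma maximalSum_le_succ (n : ℕ) (x : X) :
    maximalSum T g n x ≤ maximalSum T g (n + 1) x := by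
  induction n generalizing x with
  | zero => exact maximalSum_nonneg _ _
  | succ n ih =>
    rw [maximalSum, maximalSum]
    gcongr
    exact ih _

lemma monotone_maximalSum (x : X) : Monotone fun n => maximalSum T g n x :=
  monotone_nat_of_le_succ fun n => maximalSum_le_succ n x

lemma maximalSum_succ_le (hg : ∀ x, |g x| ≤ 1) (n : ℕ) (x : X) :
    maximalSum T g (n + 1) x ≤ maximalSum T g n x + 1 := by
  induction n generalizing x with
  | zero =>
    have := (abs_le.1 (hg x)).2
    simp [maximalSum, this]
  | succ n ih =>
    have := ih (T x)
    rw [maximalSum, maximalSum.eq_2 T g x n, ← max_add_add_right]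
    exact max_le_max (by norm_num) (by linarith)

lemma maximalSum_le (hg : ∀ x, |g x| ≤ 1) (n : ℕ) (x : X) : maximalSum T g n x ≤ n := by
  induction n with
  | zero => simp [maximalSum]
  | succ n ih =>
    push_cast
    linarith [maximalSum_succ_le (T := T) hg n x]

lemma exists_maximalSum_eq_birkhoffSum (n : ℕ) (x : X) :
    ∃ k, maximalSum T g n x = birkhoffSum T g k x := by
  induction n generalizing x with
  | zero => exact ⟨0, by simp [maximalSum]⟩
  | succ n ih =>
    rcases max_choice 0 (g x + maximalSum T g n (T x)) with h | h
    · exact ⟨0, by simp [maximalSum, h]⟩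
    · obtain ⟨k, hk⟩ := ih (T x)
      exact ⟨k + 1, by rw [maximalSum, h, hk, birkhoffSum_succ']⟩

lemma measurable_maximalSum [MeasurableSpace X] (hT : Measurable T) (hg : Measurable g) (n : ℕ) :
    Measurable (maximalSum T g n) := by
  induction n with
  | zero => exact measurable_const
  | succ n ih => exact measurable_const.max (hg.add (ih.comp hT))

lemma bddAbove_maximalSum_of_eventually_nonpos {x : X}
    (h : ∀ᶠ N in atTop, birkhoffSum T g N x ≤ 0) :
    BddAbove (Set.range fun n => maximalSum T g n x) := by
  have hb : BddAbove (Set.range fun n => birkhoffSum T g n x) :=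
    IsBoundedUnder.bddAbove_range (isBoundedUnder_of_eventually_le h)
  refine hb.mono ?_
  rintro _ ⟨n, rfl⟩
  obtain ⟨k, hk⟩ := exists_maximalSum_eq_birkhoffSum (T := T) (g := g) n x
  exact ⟨k, hk.symm⟩

lemma bddAbove_maximalSum_comp_iff (x : X) :
    BddAbove (Set.range fun n => maximalSum T g n (T x)) ↔
      BddAbove (Set.range fun n => maximalSum T g n x) := by
  constructor
  · rintro ⟨b, hb⟩
    refine ⟨max 0 (g x + b), ?_⟩
    rintro _ ⟨n, rfl⟩
    refine (maximalSum_le_succ n x).trans ?_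
    rw [maximalSum]
    gcongr
    exact hb ⟨n, rfl⟩
  · rintro ⟨b, hb⟩
    refine ⟨b - g x, ?_⟩
    rintro _ ⟨n, rfl⟩
    have h1 : maximalSum T g (n + 1) x ≤ b := hb ⟨n + 1, rfl⟩
    rw [maximalSum] at h1
    have := (le_max_right _ _).trans h1
    simp only
    linarith

/-- A bounded function of mean zero whose Birkhoff sums are almost surely bounded above
is a coboundary. -/
lemma exists_coboundary_of_ae_bddAbove [MeasurableSpace X] {μ : Measure X}
    [IsProbabilityMeasure μ] (hT : MeasurePreserving T μ μ) (hg : Measurable g)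
    (hg1 : ∀ x, |g x| ≤ 1) (hg0 : ∫ x, g x ∂μ = 0)
    (hb : ∀ᵐ x ∂μ, BddAbove (Set.range fun n => maximalSum T g n x)) :
    ∃ M : X → ℝ, Measurable M ∧ ∀ᵐ x ∂μ, M x = g x + M (T x) := by
  have hm := measurable_maximalSum hT.measurable hg
  set M : X → ℝ := fun x => ⨆ n, maximalSum T g n x
  have hM : Measurable M := Measurable.iSup hm
  have hlim : ∀ᵐ x ∂μ, Tendsto (fun n => maximalSum T g n x) atTop (nhds (M x)) := by
    filter_upwards [hb] with x hx
    exact tendsto_atTop_ciSup (monotone_maximalSum x) hx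
  have hlimT := hT.quasiMeasurePreserving.ae hlim
  have hM0 : ∀ x, 0 ≤ M x := fun x => Real.iSup_nonneg fun n => maximalSum_nonneg n x
  have hint : ∀ n, Integrable (maximalSum T g n) μ := fun n =>
    Integrable.of_bound (hm n).aestronglyMeasurable (n : ℝ) (ae_of_all _ fun x => by
      rw [Real.norm_of_nonneg (maximalSum_nonneg n x)]
      exact maximalSum_le hg1 n x)
  have hintT : ∀ n, Integrable (fun x => maximalSum T g n (T x)) μ := fun n =>
    hT.integrable_comp_of_integrable (hint n)
  have hgint : Integrable g μ :=
    Integrable.of_bound hg.aestronglyMeasurable 1 (ae_of_all _ hg1)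
  have hmax : ∀ x y : ℝ, |x| ≤ 1 → 0 ≤ y → ‖max (-y) x‖ ≤ 1 := fun x y hx hy => by
    obtain ⟨h1, h2⟩ := abs_le.1 hx
    exact abs_le.2 ⟨h1.trans (le_max_right _ _), max_le (by linarith) h2⟩
  have heq : ∀ n, ∫ x, (maximalSum T g (n + 1) x - maximalSum T g n x) ∂μ =
      ∫ x, max (-maximalSum T g n (T x)) (g x) ∂μ := by
    intro n
    have h1 : ∫ x, maximalSum T g n (T x) ∂μ = ∫ x, maximalSum T g n x ∂μ := by
      conv_rhs => rw [← hT.map_eq]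
      rw [integral_map hT.aemeasurable (hm n).aestronglyMeasurable]
    rw [integral_sub (hint _) (hint _), ← h1, ← integral_sub (hint _) (hintT _)]
    congr 1
    ext x
    rw [maximalSum, ← max_sub_sub_right]
    simp
  have hL : Tendsto (fun n => ∫ x, (maximalSum T g (n + 1) x - maximalSum T g n x) ∂μ) atTop
      (nhds (∫ _, (0 : ℝ) ∂μ)) := by
    refine tendsto_integral_of_dominated_convergence (fun _ => 1)
      (fun n => ((hm _).sub (hm _)).aestronglyMeasurable) (integrable_const _)
      (fun n => ae_of_all _ fun x => ?_) ?_
    · rw [Real.norm_of_nonneg (sub_nonneg.2 (maximalSum_le_succ n x))]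
      linarith [maximalSum_succ_le (T := T) hg1 n x]
    · filter_upwards [hlim] with x hx
      simpa using ((tendsto_add_atTop_iff_nat 1).2 hx).sub hx
  have hR : Tendsto (fun n => ∫ x, max (-maximalSum T g n (T x)) (g x) ∂μ) atTop
      (nhds (∫ x, max (-M (T x)) (g x) ∂μ)) := by
    refine tendsto_integral_of_dominated_convergence (fun _ => 1)
      (fun n => (((hm _).comp hT.measurable).neg.max hg).aestronglyMeasurable)
      (integrable_const _)
      (fun n => ae_of_all _ fun x => hmax _ _ (hg1 x) (maximalSum_nonneg n _)) ?_
    filter_upwards [hlimT] with x hx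
    exact hx.neg.max tendsto_const_nhds
  simp only [heq, integral_zero] at hL
  have hzero : ∫ x, max (-M (T x)) (g x) ∂μ = 0 := tendsto_nhds_unique hR hL
  have hmint : Integrable (fun x => max (-M (T x)) (g x)) μ :=
    Integrable.of_bound ((hM.comp hT.measurable).neg.max hg).aestronglyMeasurable 1
      (ae_of_all _ fun x => hmax _ _ (hg1 x) (hM0 _))
  have hae : (fun x => max (-M (T x)) (g x) - g x) =ᵐ[μ] 0 := by
    refine (integral_eq_zero_iff_of_nonneg (fun x => sub_nonneg.2 (le_max_right _ _))
      (hmint.sub hgint)).1 ?_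
    rw [integral_sub hmint hgint, hzero, hg0, sub_zero]
  refine ⟨M, hM, ?_⟩
  filter_upwards [hlim, hlimT, hae] with x hx hxT hxe
  have h1 : Tendsto (fun n => maximalSum T g (n + 1) x) atTop
      (nhds (max 0 (g x + M (T x)))) :=
    tendsto_const_nhds.max (tendsto_const_nhds.add hxT)
  rw [tendsto_nhds_unique ((tendsto_add_atTop_iff_nat 1).2 hx) h1]
  have h2 : max (-M (T x)) (g x) = g x := sub_eq_zero.1 hxe
  exact max_eq_right (by linarith [max_eq_right_iff.1 h2])

end MaximalSums

lemma Ergodic.ae_frequently_lt_or_ae_le {X : Type*} [MeasurableSpace X] {μ : Measure X}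
    [IsFiniteMeasure μ] {T : X → X} (hT : Ergodic T μ) {M : X → ℝ} (hM : Measurable M) (q : ℝ) :
    (∀ᵐ x ∂μ, ∃ᶠ n in atTop, M (T^[n] x) < q) ∨ ∀ᵐ x ∂μ, q ≤ M x := by
  have hs : MeasurableSet {x | M x < q} := measurableSet_lt hM measurable_const
  have hF : MeasurableSet {x | ∃ᶠ n in atTop, M (T^[n] x) < q} := by
    simp only [frequently_atTop, Set.ofPred_forall, Set.ofPred_exists, Set.ofPred_and]
    exact MeasurableSet.iInter fun a => MeasurableSet.iUnion fun b =>
      (MeasurableSet.const _).inter (hT.measurable.iterate b hs)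
  have hinv : T ⁻¹' {x | ∃ᶠ n in atTop, M (T^[n] x) < q} =
      {x | ∃ᶠ n in atTop, M (T^[n] x) < q} := by
    ext x
    simp only [Set.mem_preimage, Set.mem_ofPred_eq, ← Function.iterate_succ_apply]
    conv_rhs => rw [← map_add_atTop_eq_nat 1, frequently_map]
  refine (hT.toPreErgodic.ae_mem_or_ae_notMem hF hinv).imp id fun h => ?_
  filter_upwards [h, hT.toMeasurePreserving.conservative.ae_mem_imp_frequently_image_mem
    hs.nullMeasurableSet] with x hx hrec
  exact not_lt.1 fun hlt => hx (hrec hlt)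

/-- If `T` is totally ergodic and `g` is bounded, of mean zero, with values in a nontrivial coset
of `ℤ`, then the Birkhoff sums of `g` are almost surely infinitely often positive. -/
theorem ae_frequently_birkhoffSum_pos {X : Type*} [MeasurableSpace X] {μ : Measure X}
    [IsProbabilityMeasure μ] {T : X → X} (hT : ∀ k : ℕ, 1 ≤ k → Ergodic (T^[k]) μ)
    {g : X → ℝ} (hg : Measurable g) (hg1 : ∀ x, |g x| ≤ 1) (hg0 : ∫ x, g x ∂μ = 0)
    {α : ℝ} (hα : ∀ m : ℤ, α ≠ m) (hgα : ∀ x, ∃ m : ℤ, g x = m - α) :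
    ∀ᵐ x ∂μ, ∃ᶠ N in atTop, 0 < birkhoffSum T g N x := by
  have hT1 : Ergodic T μ := hT 1 le_rfl
  by_contra hbad
  replace hbad : ∃ᶠ x in ae μ, ∀ᶠ N in atTop, birkhoffSum T g N x ≤ 0 := by
    simpa only [Filter.Frequently, not_lt, not_not] using hbad
  have hb : ∀ᵐ x ∂μ, BddAbove (Set.range fun n => maximalSum T g n x) := by
    refine (hT1.toPreErgodic.ae_mem_or_ae_notMem
      (measurableSet_bddAbove_range (measurable_maximalSum hT1.measurable hg))
      (Set.ext bddAbove_maximalSum_comp_iff)).resolve_right fun h => ?_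
    obtain ⟨x, hx, hx'⟩ := (hbad.and_eventually h).exists
    exact hx' (bddAbove_maximalSum_of_eventually_nonpos hx)
  obtain ⟨M, hM, hcob⟩ :=
    exists_coboundary_of_ae_bddAbove hT1.toMeasurePreserving hg hg1 hg0 hb
  have hsum : ∀ᵐ x ∂μ, ∀ n, M x = birkhoffSum T g n x + M (T^[n] x) := by
    have : ∀ᵐ x ∂μ, ∀ n, M (T^[n] x) = g (T^[n] x) + M (T (T^[n] x)) := ae_all_iff.2 fun n =>
      (hT1.toMeasurePreserving.iterate n).quasiMeasurePreserving.ae hcob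
    filter_upwards [this] with x hx n
    induction n with
    | zero => simp
    | succ n ih =>
      rw [ih, hx n, birkhoffSum_succ, Function.iterate_succ_apply']
      ring
  have hdich : ∀ᵐ x ∂μ, ∀ q : ℚ, (∀ᵐ y ∂μ, (q : ℝ) ≤ M y) → (q : ℝ) ≤ M x :=
    ae_all_iff.2 fun q => by
      by_cases h : ∀ᵐ y ∂μ, (q : ℝ) ≤ M y
      · filter_upwards [h] with x hx _ using hx
      · exact ae_of_all _ fun x h' => absurd h' h
  have hfreq : ∀ᵐ x ∂μ, ∀ q : ℚ, (¬ ∀ᵐ y ∂μ, (q : ℝ) ≤ M y) →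
      ∃ᶠ n in atTop, M (T^[n] x) < q :=
    ae_all_iff.2 fun q => by
      rcases hT1.ae_frequently_lt_or_ae_le hM q with h | h
      · filter_upwards [h] with x hx _ using hx
      · exact ae_of_all _ fun x h' => absurd h h'
  have hmin : ∀ᵐ x ∂μ, (∀ᶠ N in atTop, birkhoffSum T g N x ≤ 0) →
      ∀ q : ℚ, (¬ ∀ᵐ y ∂μ, (q : ℝ) ≤ M y) → M x < q := by
    filter_upwards [hsum, hfreq] with x hs hf hx q hq
    obtain ⟨n, hn, hn'⟩ := ((hf q hq).and_eventually hx).exists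
    linarith [hs n]
  obtain ⟨c, hc⟩ : ∃ c : ℝ, ∃ᶠ x in ae μ, M x = c := by
    obtain ⟨y, hy, hyd, hym⟩ := (hbad.and_eventually (hdich.and hmin)).exists
    refine ⟨M y, (hbad.and_eventually (hdich.and hmin)).mono ?_⟩
    rintro x ⟨hx, hxd, hxm⟩
    apply le_antisymm <;> by_contra! hlt <;> obtain ⟨q, hq1, hq2⟩ := exists_rat_btwn hlt
    · exact (hxm hx q fun h => (hyd q h).not_gt hq1).not_ge hq2.le
    · exact (hym hy q fun h => (hxd q h).not_gt hq1).not_ge hq2.le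
  have hcoset : ∀ n x, ∃ m : ℤ, birkhoffSum T g n x = m - n * α := by
    intro n x
    induction n with
    | zero => exact ⟨0, by simp⟩
    | succ n ih =>
      obtain ⟨m, hm⟩ := ih
      obtain ⟨k, hk⟩ := hgα (T^[n] x)
      exact ⟨m + k, by rw [birkhoffSum_succ, hm, hk]; push_cast; ring⟩
  obtain ⟨n, hn, k, hk⟩ : ∃ n : ℕ, 1 ≤ n ∧ ∃ k : ℤ, n * α = k := by
    obtain ⟨x, hx, hs, hrec⟩ := (hc.and_eventually (hsum.and
      (hT1.toMeasurePreserving.conservative.ae_mem_imp_frequently_image_mem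
        (measurableSet_eq_fun hM (measurable_const (a := c))).nullMeasurableSet))).exists
    obtain ⟨n, hn, hn1⟩ := ((hrec hx).and_eventually (eventually_ge_atTop 1)).exists
    obtain ⟨m, hm⟩ := hcoset n x
    refine ⟨n, hn1, m, ?_⟩
    have h1 := hs n
    have h2 : M (T^[n] x) = c := hn
    linarith
  have hfract : ∀ᵐ x ∂μ, Int.fract (M (T^[n] x)) = Int.fract (M x) := by
    filter_upwards [hsum] with x hs
    obtain ⟨m, hm⟩ := hcoset n x
    refine Int.fract_eq_fract.2 ⟨k - m, ?_⟩
    push_cast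
    linarith [hs n]
  obtain ⟨r, hr⟩ := (hT n hn).ae_eq_const_of_ae_eq_comp₀
    (g := fun x => Int.fract (M x)) hM.fract.nullMeasurable hfract
  have hrT := hT1.toMeasurePreserving.quasiMeasurePreserving.ae hr
  obtain ⟨x, hx, hxT, hxc⟩ := (hr.and (hrT.and hcob)).exists
  obtain ⟨j, hj⟩ := Int.fract_eq_fract.1 (hx.trans hxT.symm)
  obtain ⟨m, hm⟩ := hgα x
  refine hα (m - j) ?_
  push_cast
  linarith

theorem stmt_12 {X : Type*} [MeasurableSpace X] (μ : Measure X) [IsProbabilityMeasure μ]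
    (T : X → X) (hT : ∀ k : ℕ, 1 ≤ k → Ergodic (T^[k]) μ)
    (E : Set X) (hE : MeasurableSet E) (hE0 : 0 < μ E) (hE1 : μ E < 1) :
    ∀ᵐ x ∂μ,
      (∃ᶠ N in atTop,
        birkhoffAvg T (E.indicator fun _ => (1 : ℝ)) N x > (μ E).toReal) ∧
      (∃ᶠ N in atTop,
        birkhoffAvg T (E.indicator fun _ => (1 : ℝ)) N x < (μ E).toReal) := by
  have hT1 : MeasurePreserving T μ μ := (hT 1 le_rfl).toMeasurePreserving
  set α : ℝ := (μ E).toReal with hαdef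
  have hα0 : 0 < α := ENNReal.toReal_pos hE0.ne' (measure_ne_top _ _)
  have hα1 : α < 1 := by
    simpa using (ENNReal.toReal_lt_toReal (measure_ne_top _ _) ENNReal.one_ne_top).2 hE1
  have hαZ : ∀ m : ℤ, α ≠ m := fun m hm => by
    rw [hm] at hα0 hα1
    have h0 : 0 < m := by exact_mod_cast hα0
    have h1 : m < 1 := by exact_mod_cast hα1
    omega
  set e : X → ℝ := E.indicator fun _ => (1 : ℝ)
  have he : Measurable e := measurable_const.indicator hE
  have he01 : ∀ x, e x = 0 ∨ e x = 1 := fun x => by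
    by_cases h : x ∈ E <;> simp [e, h]
  set g : X → ℝ := fun x => e (T x) - α
  have hg : Measurable g := (he.comp hT1.measurable).sub_const α
  have hg1 : ∀ x, |g x| ≤ 1 := fun x => by
    rw [abs_le]
    rcases he01 (T x) with h | h <;> simp only [g, h] <;> constructor <;> linarith
  have hg0 : ∫ x, g x ∂μ = 0 := by
    have hi : Integrable e μ := (integrable_const (1 : ℝ)).indicator hE
    have h1 : ∫ x, e (T x) ∂μ = ∫ x, e x ∂μ := by
      conv_rhs => rw [← hT1.map_eq]
      rw [integral_map hT1.aemeasurable he.aestronglyMeasurable]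
    have h2 : ∫ x, e x ∂μ = α := by
      simp [e, integral_indicator hE, hαdef, Measure.real]
    have h3 : ∫ x, g x ∂μ = ∫ x, e (T x) ∂μ - ∫ _, α ∂μ :=
      integral_sub (hT1.integrable_comp_of_integrable hi) (integrable_const _)
    rw [h3, h1, h2]
    simp
  have hgα : ∀ x, ∃ m : ℤ, g x = m - α := fun x => by
    rcases he01 (T x) with h | h
    · exact ⟨0, by simp [g, h]⟩
    · exact ⟨1, by simp [g, h]⟩
  have hpos := ae_frequently_birkhoffSum_pos hT hg hg1 hg0 hαZ hgα
  have hneg := ae_frequently_birkhoffSum_pos (g := fun x => -g x) (α := -α) hT hg.neg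
    (fun x => by simpa using hg1 x) (by rw [integral_neg, hg0, neg_zero])
    (fun m hm => hαZ (-m) (by push_cast; linarith))
    (fun x => by
      obtain ⟨m, hm⟩ := hgα x
      exact ⟨-m, by rw [hm]; push_cast; ring⟩)
  have hsum : ∀ N x, ∑ n ∈ Finset.Icc 1 N, e (T^[n] x) = birkhoffSum T g N x + N * α := by
    intro N x
    induction N with
    | zero => simp
    | succ N ih =>
      rw [Finset.sum_Icc_succ_top (by omega), ih, birkhoffSum_succ,
        Function.iterate_succ_apply']
      simp only [g]
      push_cast
      ring
  have havg : ∀ N : ℕ, 1 ≤ N → ∀ x,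
      birkhoffAvg T e N x = α + (N : ℝ)⁻¹ * birkhoffSum T g N x := by
    intro N hN x
    have : (N : ℝ) ≠ 0 := by positivity
    rw [birkhoffAvg, hsum]
    field_simp
    ring
  filter_upwards [hpos, hneg] with x hp hn
  constructor
  · refine (hp.and_eventually (eventually_ge_atTop 1)).mono fun N ⟨h, hN⟩ => ?_
    have hN0 : (0 : ℝ) < (N : ℝ)⁻¹ := by positivity
    rw [havg N hN]
    linarith [mul_pos hN0 h]
  · refine (hn.and_eventually (eventually_ge_atTop 1)).mono fun N ⟨h, hN⟩ => ?_
    have hN0 : (0 : ℝ) < (N : ℝ)⁻¹ := by positivity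
    have h' : birkhoffSum T g N x < 0 := by
      simpa [birkhoffSum] using h
    rw [havg N hN]
    linarith [mul_neg_of_pos_of_neg hN0 h']
end

section
/- Let (X, μ) be a probability space, T : X → X a totally ergodic measure-preserving transformation, and (N_i)_{i≥1} a strictly increasing sequence of positive integers. Suppose there exist a constant K ∈ ℕ and a strictly increasing sequence of indices (i_j)_{j≥1} such that N_{i_j + 1} − N_{i_j} = K for all j, and such that the sequence (N_{i_j})_j satisfies the complete recurrence property for (X, μ, T). Then for every real-valued f ∈ L¹(μ) that is not a.e. constant, for almost every x ∈ X, A_{N_{i+1}} f(x) > A_{N_i} f(x) for infinitely many i and A_{N_{i+1}} f(x) < A_{N_i} f(x) for infinitely many i. -/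
open MeasureTheory Filter

open Topology

theorem birkhoffAvg_eq_birkhoffAverage_apply {X : Type*} (T : X → X) (f : X → ℝ) (n : ℕ) (x : X) :
    birkhoffAvg T f n x = birkhoffAverage ℝ T f n (T x) := by
  rw [birkhoffAvg, birkhoffAverage, smul_eq_mul, birkhoffSum, Finset.range_eq_Ico,
    ← Finset.Ico_add_one_right_eq_Icc]
  congr 1
  simpa [Function.iterate_succ_apply] using
    (Finset.sum_Ico_add' (fun k => f (T^[k] x)) 0 n 1).symm

section ErgodicMaximum

variable {X : Type*}

/-- The running maximum `max_{0 ≤ k ≤ n} ∑_{j < k} h (T^j x)` of the Birkhoff sums of `h`. -/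
noncomputable def birkhoffMax (T : X → X) (h : X → ℝ) : ℕ → X → ℝ
  | 0, _ => 0
  | n + 1, x => max 0 (h x + birkhoffMax T h n (T x))

theorem birkhoffMax_nonneg (T : X → X) (h : X → ℝ) (n : ℕ) (x : X) :
    0 ≤ birkhoffMax T h n x := by
  cases n with
  | zero => exact le_rfl
  | succ n => exact le_max_left _ _

theorem birkhoffMax_le_succ (T : X → X) (h : X → ℝ) (n : ℕ) (x : X) :
    birkhoffMax T h n x ≤ birkhoffMax T h (n + 1) x := by
  induction n generalizing x with
  | zero => exact birkhoffMax_nonneg T h 1 x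
  | succ n ih =>
    simp only [birkhoffMax]
    exact max_le_max le_rfl (by simpa only [birkhoffMax] using add_le_add_right (ih (T x)) (h x))

theorem birkhoffSum_le_birkhoffMax (T : X → X) (h : X → ℝ) (n : ℕ) (x : X) :
    birkhoffSum T h n x ≤ birkhoffMax T h n x := by
  induction n generalizing x with
  | zero => simp [birkhoffMax]
  | succ n ih =>
    rw [birkhoffSum_succ']
    exact (add_le_add_right (ih (T x)) (h x)).trans (le_max_right _ _)

theorem bddAbove_birkhoffMax_apply_iff (T : X → X) (h : X → ℝ) (x : X) :
    BddAbove (Set.range fun n => birkhoffMax T h n (T x)) ↔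
      BddAbove (Set.range fun n => birkhoffMax T h n x) := by
  constructor
  · rintro ⟨C, hC⟩
    refine ⟨max 0 (h x + C), ?_⟩
    rintro _ ⟨n, rfl⟩
    refine (birkhoffMax_le_succ T h n x).trans (max_le_max le_rfl ?_)
    exact add_le_add_right (hC ⟨n, rfl⟩) _
  · rintro ⟨C, hC⟩
    refine ⟨C - h x, ?_⟩
    rintro _ ⟨n, rfl⟩
    have h₁ : birkhoffMax T h (n + 1) x ≤ C := hC ⟨n + 1, rfl⟩
    have h₂ : h x + birkhoffMax T h n (T x) ≤ birkhoffMax T h (n + 1) x := le_max_right _ _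
    show birkhoffMax T h n (T x) ≤ C - h x
    linarith

variable [MeasurableSpace X] {μ : Measure X} {T : X → X} {h : X → ℝ}

theorem measurable_birkhoffMax (hT : Measurable T) (hh : Measurable h) (n : ℕ) :
    Measurable (birkhoffMax T h n) := by
  induction n with
  | zero => exact measurable_const
  | succ n ih => exact measurable_const.max (hh.add (ih.comp hT))

theorem MeasureTheory.MeasurePreserving.integral_comp_of_integrable {Y : Type*} [MeasurableSpace Y]
    {ν : Measure Y} {S : X → Y} (hS : MeasurePreserving S μ ν) {g : Y → ℝ} (hg : Integrable g ν) :
    ∫ x, g (S x) ∂μ = ∫ y, g y ∂ν := by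
  have hgm : AEStronglyMeasurable g (μ.map S) := hS.map_eq.symm ▸ hg.aestronglyMeasurable
  rw [← integral_map hS.aemeasurable hgm, hS.map_eq]

theorem integrable_birkhoffMax [IsFiniteMeasure μ] (hT : MeasurePreserving T μ μ)
    (hh : Integrable h μ) (n : ℕ) : Integrable (birkhoffMax T h n) μ := by
  induction n with
  | zero => exact integrable_const (0 : ℝ)
  | succ n ih =>
    exact (integrable_const (0 : ℝ)).sup (hh.add (hT.integrable_comp_of_integrable ih))

theorem integral_nonneg_of_not_bddAbove_birkhoffMax [IsFiniteMeasure μ]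
    (hT : MeasurePreserving T μ μ) (hh : Integrable h μ)
    (hub : ∀ᵐ x ∂μ, ¬ BddAbove (Set.range fun n => birkhoffMax T h n x)) :
    0 ≤ ∫ x, h x ∂μ := by
  have hM := integrable_birkhoffMax hT hh
  have hMT : ∀ n, Integrable (fun x => birkhoffMax T h n (T x)) μ := fun n =>
    hT.integrable_comp_of_integrable (hM n)
  have hlim : Tendsto (fun n => ∫ x, (birkhoffMax T h (n + 1) x - birkhoffMax T h n (T x)) ∂μ)
      atTop (𝓝 (∫ x, h x ∂μ)) := by
    refine tendsto_integral_of_dominated_convergence (fun x => |h x|)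
      (fun n => ((hM (n + 1)).sub (hMT n)).aestronglyMeasurable) hh.abs
      (fun n => ae_of_all _ fun x => ?_) ?_
    · have h₀ := birkhoffMax_nonneg T h n (T x)
      rw [Real.norm_eq_abs, abs_le, birkhoffMax]
      have h₁ := neg_abs_le (h x)
      have h₂ := le_abs_self (h x)
      have h₃ := abs_nonneg (h x)
      constructor
      · linarith [le_max_right 0 (h x + birkhoffMax T h n (T x))]
      · rw [sub_le_iff_le_add]
        exact max_le (by linarith) (by linarith)
    · filter_upwards [hub] with x hx
      rw [← bddAbove_birkhoffMax_apply_iff] at hx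
      have hmono : Monotone fun n => birkhoffMax T h n (T x) :=
        monotone_nat_of_le_succ fun n => birkhoffMax_le_succ T h n (T x)
      have htop := tendsto_atTop_atTop_of_monotone' hmono hx
      refine tendsto_const_nhds.congr' ?_
      filter_upwards [htop.eventually_ge_atTop (-h x)] with n hn
      rw [birkhoffMax, max_eq_right (by linarith)]
      ring
  refine ge_of_tendsto' hlim fun n => ?_
  have hcomp : ∫ x, birkhoffMax T h n (T x) ∂μ = ∫ x, birkhoffMax T h n x ∂μ :=
    hT.integral_comp_of_integrable (hM n)
  rw [integral_sub (hM (n + 1)) (hMT n), hcomp, sub_nonneg]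
  exact integral_mono (hM n) (hM (n + 1)) fun x => birkhoffMax_le_succ T h n x

theorem Ergodic.ae_bddAbove_birkhoffMax [IsFiniteMeasure μ] (hT : Ergodic T μ)
    (hm : Measurable h) (hh : Integrable h μ) (hneg : ∫ x, h x ∂μ < 0) :
    ∀ᵐ x ∂μ, BddAbove (Set.range fun n => birkhoffMax T h n x) := by
  have hs : MeasurableSet {x | BddAbove (Set.range fun n => birkhoffMax T h n x)} :=
    measurableSet_bddAbove_range fun n => measurable_birkhoffMax hT.measurable hm n
  have hinv : T ⁻¹' {x | BddAbove (Set.range fun n => birkhoffMax T h n x)} =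
      {x | BddAbove (Set.range fun n => birkhoffMax T h n x)} :=
    Set.ext fun x => bddAbove_birkhoffMax_apply_iff T h x
  rcases hT.ae_mem_or_ae_notMem hs hinv with hall | hnone
  · exact hall
  · exact absurd
      (integral_nonneg_of_not_bddAbove_birkhoffMax hT.toMeasurePreserving hh hnone) hneg.not_ge

/-- The upper half of Birkhoff's pointwise ergodic theorem for ergodic transformations. -/
theorem Ergodic.ae_eventually_birkhoffAverage_lt [IsProbabilityMeasure μ] (hT : Ergodic T μ)
    (hm : Measurable h) (hh : Integrable h μ) {a : ℝ} (ha : ∫ x, h x ∂μ < a) :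
    ∀ᵐ x ∂μ, ∀ᶠ n in atTop, birkhoffAverage ℝ T h n x < a := by
  obtain ⟨b, hb, hba⟩ := exists_between ha
  have hint : ∫ x, (h x - b) ∂μ < 0 := by
    rw [integral_sub hh (integrable_const b)]
    simpa using hb
  filter_upwards [hT.ae_bddAbove_birkhoffMax (hm.sub_const b) (hh.sub (integrable_const b)) hint]
    with x hx
  obtain ⟨C, hC⟩ := hx
  have hlarge : ∀ᶠ n : ℕ in atTop, C / (a - b) < n :=
    tendsto_natCast_atTop_atTop.eventually_gt_atTop _
  filter_upwards [hlarge, eventually_gt_atTop 0] with n hn hn0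
  have hnpos : (0 : ℝ) < n := Nat.cast_pos.mpr hn0
  have h₁ : birkhoffSum T (fun x => h x - b) n x ≤ C :=
    (birkhoffSum_le_birkhoffMax T _ n x).trans (hC ⟨n, rfl⟩)
  have h₂ : birkhoffSum T (fun x => h x - b) n x = birkhoffSum T h n x - n * b := by
    simp [birkhoffSum, Finset.sum_sub_distrib]
  rw [div_lt_iff₀ (sub_pos.mpr hba)] at hn
  rw [birkhoffAverage, smul_eq_mul, inv_mul_lt_iff₀ hnpos]
  linarith

end ErgodicMaximum

section Oscillation

variable {X : Type*} [MeasurableSpace X] {μ : Measure X} {T : X → X} {f : X → ℝ}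

theorem birkhoffSum_not_ae_eq_const {K : ℕ} (hT : MeasurePreserving T μ μ)
    (hTK : Ergodic T^[K] μ) (hf : AEStronglyMeasurable f μ)
    (hnc : ¬ ∃ c : ℝ, f =ᵐ[μ] fun _ => c) (d : ℝ) :
    ¬ birkhoffSum T f K =ᵐ[μ] fun _ => d := by
  intro hd
  have hdT : ∀ᵐ x ∂μ, birkhoffSum T f K (T x) = d := hT.quasiMeasurePreserving.ae hd
  refine hnc (hTK.ae_eq_const_of_ae_eq_comp_ae hf ?_)
  filter_upwards [hd, hdT] with x h₁ h₂
  have h₃ := birkhoffSum_apply_sub_birkhoffSum T f K x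
  rw [h₂, h₁, sub_self] at h₃
  exact (sub_eq_zero.mp h₃.symm)

theorem exists_measure_lt_pos_of_not_ae_eq_const [IsProbabilityMeasure μ] {g : X → ℝ}
    (hg : Integrable g μ) (hne : ¬ g =ᵐ[μ] fun _ => ∫ x, g x ∂μ) :
    ∃ a, ∫ x, g x ∂μ < a ∧ 0 < μ {x | a < g x} := by
  by_contra! hcon
  refine hne ?_
  have hle : ∀ᵐ x ∂μ, g x ≤ ∫ x, g x ∂μ := by
    have hall : ∀ᵐ x ∂μ, ∀ m : ℕ, g x ≤ ∫ x, g x ∂μ + 1 / ((m : ℝ) + 1) := by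
      refine ae_all_iff.mpr fun m => ?_
      have hnull := nonpos_iff_eq_zero.mp
        (hcon (∫ x, g x ∂μ + 1 / ((m : ℝ) + 1)) (lt_add_of_pos_right _ (by positivity)))
      rw [ae_iff]
      simpa only [not_le] using hnull
    filter_upwards [hall] with x hx
    refine ge_of_tendsto' (x := atTop) ?_ hx
    simpa using tendsto_one_div_add_atTop_nhds_zero_nat.const_add (∫ x, g x ∂μ)
  have hzero : ∫ x, (∫ y, g y ∂μ - g x) ∂μ = 0 := by
    rw [integral_sub (integrable_const _) hg]
    simp
  have hae := (integral_eq_zero_iff_of_nonneg_ae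
    (by filter_upwards [hle] with x hx using sub_nonneg.mpr hx)
    ((integrable_const _).sub hg)).mp hzero
  filter_upwards [hae] with x hx
  exact (sub_eq_zero.mp hx).symm

theorem integrable_birkhoffSum (hT : MeasurePreserving T μ μ) (hf : Integrable f μ) (n : ℕ) :
    Integrable (birkhoffSum T f n) μ :=
  integrable_finsetSum _ fun k _ => (hT.iterate k).integrable_comp_of_integrable hf

theorem integral_birkhoffSum (hT : MeasurePreserving T μ μ) (hf : Integrable f μ) (n : ℕ) :
    ∫ x, birkhoffSum T f n x ∂μ = n * ∫ x, f x ∂μ := by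
  have hcomp : ∀ k, ∫ x, f (T^[k] x) ∂μ = ∫ x, f x ∂μ := fun k =>
    (hT.iterate k).integral_comp_of_integrable hf
  calc ∫ x, birkhoffSum T f n x ∂μ = ∑ k ∈ Finset.range n, ∫ x, f (T^[k] x) ∂μ :=
        integral_finsetSum _ fun k _ => (hT.iterate k).integrable_comp_of_integrable hf
    _ = n * ∫ x, f x ∂μ := by simp [hcomp]

theorem ae_frequently_birkhoffAverage_lt_succ [IsProbabilityMeasure μ]
    (hT : ∀ k : ℕ, 1 ≤ k → Ergodic T^[k] μ) {N : ℕ → ℕ} (hmono : StrictMono N)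
    {K : ℕ} {idx : ℕ → ℕ} (hidx : StrictMono idx)
    (hgap : ∀ j, N (idx j + 1) - N (idx j) = K)
    (hrec : ∀ E : Set X, MeasurableSet E → 0 < μ E →
      ∀ L : ℕ, μ (⋃ j ∈ Set.Ici L, T^[N (idx j)] ⁻¹' E) = 1)
    (hm : Measurable f) (hf : Integrable f μ) (hnc : ¬ ∃ c : ℝ, f =ᵐ[μ] fun _ => c) :
    ∀ᵐ x ∂μ, ∃ᶠ i in atTop,
      birkhoffAverage ℝ T f (N i) x < birkhoffAverage ℝ T f (N (i + 1)) x := by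
  have hT₁ : Ergodic T μ := by simpa using hT 1 le_rfl
  have hKpos : 0 < K := by
    rw [← hgap 0]
    exact Nat.sub_pos_of_lt (hmono (Nat.lt_succ_self _))
  have hKpos' : (0 : ℝ) < K := Nat.cast_pos.mpr hKpos
  obtain ⟨a, ha, hE⟩ := exists_measure_lt_pos_of_not_ae_eq_const
    (integrable_birkhoffSum hT₁.toMeasurePreserving hf K)
    (birkhoffSum_not_ae_eq_const hT₁.toMeasurePreserving (hT K hKpos) hf.1 hnc _)
  rw [integral_birkhoffSum hT₁.toMeasurePreserving hf, mul_comm, ← lt_div_iff₀ hKpos'] at ha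
  have hEm : MeasurableSet {x | a < birkhoffSum T f K x} :=
    measurableSet_lt measurable_const
      (Finset.measurable_fun_sum _ fun k _ => hm.comp (hT₁.measurable.iterate k))
  have hvisit : ∀ᵐ x ∂μ, ∀ L : ℕ, ∃ j ≥ L, a < birkhoffSum T f K (T^[N (idx j)] x) := by
    refine ae_all_iff.mpr fun L => ?_
    have hmeas : MeasurableSet
        (⋃ j ∈ Set.Ici L, T^[N (idx j)] ⁻¹' {x | a < birkhoffSum T f K x}) :=
      MeasurableSet.biUnion (Set.to_countable _) fun j _ => hT₁.measurable.iterate _ hEm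
    filter_upwards [(mem_ae_iff_prob_eq_one hmeas).mpr (hrec _ hEm hE L)] with x hx
    simpa using hx
  filter_upwards [hvisit, hT₁.ae_eventually_birkhoffAverage_lt hm hf ha] with x hx hlt
  obtain ⟨n₀, hn₀⟩ := eventually_atTop.mp hlt
  refine frequently_atTop.mpr fun L => ?_
  obtain ⟨j, hj, hja⟩ := hx (max L (n₀ + 1))
  have hjidx : j ≤ idx j := hidx.le_apply
  have hidxN : idx j ≤ N (idx j) := hmono.le_apply
  have hjL := le_of_max_le_left hj
  have hjn := le_of_max_le_right hj
  refine ⟨idx j, by omega, ?_⟩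
  have hNsucc : N (idx j + 1) = N (idx j) + K := by
    have := hgap j
    have := hmono (Nat.lt_succ_self (idx j))
    omega
  have havg := hn₀ (N (idx j)) (by omega)
  have hNpos : (0 : ℝ) < N (idx j) := Nat.cast_pos.mpr (by omega)
  rw [hNsucc]
  simp only [birkhoffAverage, smul_eq_mul, Nat.cast_add, birkhoffSum_add, inv_mul_eq_div]
    at havg ⊢
  rw [div_lt_div_iff₀ hNpos hKpos'] at havg
  rw [div_lt_div_iff₀ hNpos (by positivity)]
  nlinarith [mul_lt_mul_of_pos_right hja hNpos]

end Oscillation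

theorem stmt_14 {X : Type*} [MeasurableSpace X] (μ : Measure X) [IsProbabilityMeasure μ]
    (T : X → X) (hT : ∀ k : ℕ, 1 ≤ k → Ergodic (T^[k]) μ)
    (N : ℕ → ℕ) (hmono : StrictMono N) (hpos : ∀ i, 1 ≤ N i)
    (K : ℕ) (idx : ℕ → ℕ) (hidx : StrictMono idx)
    (hgap : ∀ j, N (idx j + 1) - N (idx j) = K)
    (hrec : ∀ E : Set X, MeasurableSet E → 0 < μ E →
      ∀ L : ℕ, μ (⋃ j ∈ Set.Ici L, T^[N (idx j)] ⁻¹' E) = 1)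
    (f : X → ℝ) (hf : Integrable f μ) (hnc : ¬ ∃ c : ℝ, f =ᵐ[μ] fun _ => c) :
    ∀ᵐ x ∂μ,
      (∃ᶠ i in atTop, birkhoffAvg T f (N (i + 1)) x > birkhoffAvg T f (N i) x) ∧
      (∃ᶠ i in atTop, birkhoffAvg T f (N (i + 1)) x < birkhoffAvg T f (N i) x) := by
  have hT₁ : Ergodic T μ := by simpa using hT 1 le_rfl
  have hg : f =ᵐ[μ] hf.1.mk f := hf.1.ae_eq_mk
  have hgm : Measurable (hf.1.mk f) := hf.1.stronglyMeasurable_mk.measurable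
  have hgi : Integrable (hf.1.mk f) μ := hf.congr hg
  have hgnc : ¬ ∃ c : ℝ, hf.1.mk f =ᵐ[μ] fun _ => c := fun ⟨c, hc⟩ => hnc ⟨c, hg.trans hc⟩
  have hgnc' : ¬ ∃ c : ℝ, -hf.1.mk f =ᵐ[μ] fun _ => c := fun ⟨c, hc⟩ =>
    hgnc ⟨-c, by filter_upwards [hc] with x hx using by rw [← hx, Pi.neg_apply, neg_neg]⟩
  have heq : ∀ᵐ x ∂μ, ∀ n, birkhoffAverage ℝ T f n x = birkhoffAverage ℝ T (hf.1.mk f) n x :=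
    ae_all_iff.mpr fun n =>
      hT₁.toMeasurePreserving.quasiMeasurePreserving.birkhoffAverage_ae_eq_of_ae_eq ℝ hg n
  simp only [birkhoffAvg_eq_birkhoffAverage_apply]
  refine hT₁.toMeasurePreserving.quasiMeasurePreserving.ae (p := fun y =>
    (∃ᶠ i in atTop, birkhoffAverage ℝ T f (N (i + 1)) y > birkhoffAverage ℝ T f (N i) y) ∧
    (∃ᶠ i in atTop, birkhoffAverage ℝ T f (N (i + 1)) y < birkhoffAverage ℝ T f (N i) y)) ?_
  filter_upwards [heq, ae_frequently_birkhoffAverage_lt_succ hT hmono hidx hgap hrec hgm hgi hgnc,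
    ae_frequently_birkhoffAverage_lt_succ hT hmono hidx hgap hrec hgm.neg hgi.neg hgnc']
    with x hx hup hdown
  simp only [hx]
  refine ⟨hup, ?_⟩
  simpa only [birkhoffAverage_neg, Pi.neg_apply, neg_lt_neg_iff] using hdown
end

section
/- Let (x_n)_{n≥1} be a uniformly distributed sequence in [0,1] and let f : [0,1] → ℝ be continuous and non-constant. Writing A_N = (1/N) ∑_{n=1}^{N} f(x_n), there exists d > 0 such that A_{N+1} > d/N + A_N for infinitely many N and A_{N+1} < −d/N + A_N for infinitely many N. -/
open MeasureTheory Filter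

/-- Average `A_N = (1/N) ∑_{n=1}^N f(x_n)` of `f` along a sequence. -/
noncomputable def seqAvg (f : ℝ → ℝ) (x : ℕ → ℝ) (N : ℕ) : ℝ :=
  (N : ℝ)⁻¹ * ∑ n ∈ Finset.Icc 1 N, f (x n)

theorem seqAvg_eq_sum_range (f : ℝ → ℝ) (x : ℕ → ℝ) (N : ℕ) :
    seqAvg f x N = (N : ℝ)⁻¹ * ∑ n ∈ Finset.range N, f (x (n + 1)) := by
  rw [seqAvg, Finset.range_eq_Ico, Finset.sum_Ico_add' (fun n => f (x n)) 0 N 1]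
  rfl

theorem seqAvg_neg (f : ℝ → ℝ) (x : ℕ → ℝ) (N : ℕ) :
    seqAvg (fun t => -f t) x N = -seqAvg f x N := by
  simp [seqAvg]

theorem seqAvg_succ_sub (f : ℝ → ℝ) (x : ℕ → ℝ) {N : ℕ} (hN : N ≠ 0) :
    seqAvg f x (N + 1) - seqAvg f x N = (f (x (N + 1)) - seqAvg f x N) / (N + 1) := by
  have h0 : (N : ℝ) ≠ 0 := by exact_mod_cast hN
  have h1 : (N : ℝ) + 1 ≠ 0 := by positivity
  rw [seqAvg_eq_sum_range, seqAvg_eq_sum_range, Finset.sum_range_succ]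
  push_cast
  field_simp
  ring

theorem setIntegral_Icc_pos_of_continuousOn {g : ℝ → ℝ} {a b : ℝ} (hab : a < b)
    (hg : ContinuousOn g (Set.Icc a b)) (h0 : ∀ t ∈ Set.Icc a b, 0 ≤ g t)
    (hpos : ∃ s ∈ Set.Icc a b, 0 < g s) : 0 < ∫ t in Set.Icc a b, g t := by
  rw [integral_Icc_eq_integral_Ioc, ← intervalIntegral.integral_of_le hab.le]
  exact intervalIntegral.integral_pos hab hg (fun t ht => h0 t (Set.Ioc_subset_Icc_self ht)) hpos

/-- A nonconstant continuous function on `[0, 1]` exceeds its mean somewhere. -/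
theorem exists_setIntegral_lt_of_not_const {f : ℝ → ℝ} (hf : ContinuousOn f (Set.Icc (0 : ℝ) 1))
    (hnc : ¬ ∃ c : ℝ, ∀ t ∈ Set.Icc (0 : ℝ) 1, f t = c) :
    ∃ s ∈ Set.Icc (0 : ℝ) 1, ∫ t in Set.Icc (0 : ℝ) 1, f t < f s := by
  by_contra! hle
  push Not at hnc
  set I := ∫ t in Set.Icc (0 : ℝ) 1, f t with hI
  obtain ⟨s, hs, hne⟩ := hnc I
  have hpos := setIntegral_Icc_pos_of_continuousOn (g := fun t => I - f t) zero_lt_one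
    (continuousOn_const.sub hf) (fun t ht => sub_nonneg.2 (hle t ht))
    ⟨s, hs, sub_pos.2 (lt_of_le_of_ne (hle s hs) hne)⟩
  rw [integral_sub (by simp) hf.integrableOn_Icc, ← hI] at hpos
  simp at hpos

/-- A uniformly distributed sequence visits every nonempty set `{f > c}`, with `f` continuous,
infinitely often. -/
theorem frequently_lt_of_uniformly_distributed {x : ℕ → ℝ}
    (hud : ∀ g : ℝ → ℝ, ContinuousOn g (Set.Icc (0 : ℝ) 1) →
      Tendsto (fun N => seqAvg g x N) atTop (nhds (∫ t in Set.Icc (0 : ℝ) 1, g t)))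
    {f : ℝ → ℝ} (hf : ContinuousOn f (Set.Icc (0 : ℝ) 1)) {c : ℝ}
    (hc : ∃ s ∈ Set.Icc (0 : ℝ) 1, c < f s) : ∃ᶠ N in atTop, c < f (x (N + 1)) := by
  intro hev
  obtain ⟨s, hs, hcs⟩ := hc
  have hg : ContinuousOn (fun t => max (f t - c) 0) (Set.Icc (0 : ℝ) 1) :=
    ContinuousOn.sup (hf.sub continuousOn_const) continuousOn_const
  have hpos := setIntegral_Icc_pos_of_continuousOn zero_lt_one hg
    (fun t _ => le_max_right _ _) ⟨s, hs, lt_max_of_lt_left (sub_pos.2 hcs)⟩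
  have hzero : Tendsto (fun n => max (f (x (n + 1)) - c) 0) atTop (nhds 0) := by
    refine tendsto_const_nhds.congr' ?_
    filter_upwards [hev] with n hn
    exact (max_eq_right (sub_nonpos.2 (not_lt.1 hn))).symm
  have havg := hzero.cesaro
  simp_rw [← seqAvg_eq_sum_range (fun t => max (f t - c) 0) x] at havg
  exact hpos.ne (tendsto_nhds_unique havg (hud _ hg))

theorem exists_forall_le_frequently_seqAvg_succ_gt {x : ℕ → ℝ}
    (hud : ∀ g : ℝ → ℝ, ContinuousOn g (Set.Icc (0 : ℝ) 1) →
      Tendsto (fun N => seqAvg g x N) atTop (nhds (∫ t in Set.Icc (0 : ℝ) 1, g t)))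
    {f : ℝ → ℝ} (hf : ContinuousOn f (Set.Icc (0 : ℝ) 1))
    (hnc : ¬ ∃ c : ℝ, ∀ t ∈ Set.Icc (0 : ℝ) 1, f t = c) :
    ∃ d₀ : ℝ, 0 < d₀ ∧ ∀ d ≤ d₀, ∃ᶠ N in atTop,
      seqAvg f x (N + 1) > d / (N : ℝ) + seqAvg f x N := by
  obtain ⟨s, hs, hlt⟩ := exists_setIntegral_lt_of_not_const hf hnc
  set I := ∫ t in Set.Icc (0 : ℝ) 1, f t
  refine ⟨(f s - I) / 4, by linarith, fun d hd => ?_⟩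
  have hfreq := frequently_lt_of_uniformly_distributed hud hf
    (c := I + 3 * ((f s - I) / 4)) ⟨s, hs, by linarith⟩
  have hA : ∀ᶠ N in atTop, seqAvg f x N < I + (f s - I) / 4 :=
    (hud f hf).eventually_lt_const (by linarith)
  refine (hfreq.and_eventually (hA.and (eventually_ge_atTop 1))).mono ?_
  rintro N ⟨hxN, hAN, hN⟩
  have hN' : (1 : ℝ) ≤ N := by exact_mod_cast hN
  have hd' : d / N < (f (x (N + 1)) - seqAvg f x N) / (N + 1) := by
    rw [div_lt_div_iff₀ (by linarith) (by linarith)]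
    nlinarith
  rw [← seqAvg_succ_sub f x (by omega)] at hd'
  linarith

theorem stmt_17 (x : ℕ → ℝ) (hx : ∀ n, x n ∈ Set.Icc (0 : ℝ) 1)
    (hud : ∀ g : ℝ → ℝ, ContinuousOn g (Set.Icc (0 : ℝ) 1) →
      Tendsto (fun N => seqAvg g x N) atTop (nhds (∫ t in Set.Icc (0 : ℝ) 1, g t)))
    (f : ℝ → ℝ) (hf : ContinuousOn f (Set.Icc (0 : ℝ) 1))
    (hnc : ¬ ∃ c : ℝ, ∀ t ∈ Set.Icc (0 : ℝ) 1, f t = c) :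
    ∃ d : ℝ, 0 < d ∧
      (∃ᶠ N in atTop, seqAvg f x (N + 1) > d / (N : ℝ) + seqAvg f x N) ∧
      (∃ᶠ N in atTop, seqAvg f x (N + 1) < -(d / (N : ℝ)) + seqAvg f x N) := by
  obtain ⟨d₁, hd₁, h₁⟩ := exists_forall_le_frequently_seqAvg_succ_gt hud hf hnc
  obtain ⟨d₂, hd₂, h₂⟩ := exists_forall_le_frequently_seqAvg_succ_gt hud (f := fun t => -f t)
    hf.neg (fun ⟨c, hc⟩ => hnc ⟨-c, fun t ht => by rw [← hc t ht, neg_neg]⟩)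
  refine ⟨min d₁ d₂, lt_min hd₁ hd₂, h₁ _ (min_le_left _ _),
    (h₂ _ (min_le_right d₁ d₂)).mono fun N hN => ?_⟩
  rw [seqAvg_neg, seqAvg_neg] at hN
  linarith
end
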